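/- Fix d ≥ 2. Let ρ be a norm on ℝ^d invariant under permutations and sign flips of the coordinates, and let J(x) = ψ(x) e^{−ρ(x)} for x ≠ 0 with J(0) = 0, where ψ : ℤ^d → ℝ≥0 satisfies lim_{‖x‖→∞} log ψ(x)/‖x‖ = 0, J(−x) = J(x), and J(x) = 1 whenever ‖x‖ = 1. Then for every λ > 0 there exists β_0 such that for every β ≥ β_0 there is a constant C > 0 with the following property: for every N ≥ 1 and every x ∈ Λ_N with x ≠ 0, the truncated two-point function of the Ising model in Λ_N with plus boundary conditions satisfies Cov_{μ^+_{Λ_N;β}}(σ_0, σ_x) ≤ C · G^{KRW}_λ(0,x). -/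

import Mathlib

open scoped BigOperators ENNReal

noncomputable section

/-- The lattice `ℤ^d`. -/
abbrev Zd (d : ℕ) := Fin d → ℤ

/-- Standard inner product `⟨t, x⟩` between `t ∈ ℝ^d` and a lattice point `x ∈ ℤ^d`. -/
def dotp {d : ℕ} (t : Fin d → ℝ) (x : Zd d) : ℝ := ∑ i, t i * (x i : ℝ)

/-- Canonical embedding `ℤ^d ↪ ℝ^d`. -/
def toR {d : ℕ} (x : Zd d) : Fin d → ℝ := fun i => (x i : ℝ)

/-- Standard inner product on `ℝ^d`. -/
def dotR {d : ℕ} (t x : Fin d → ℝ) : ℝ := ∑ i, t i * x i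

/-- Euclidean norm of a lattice point. -/
def eNorm {d : ℕ} (x : Zd d) : ℝ := Real.sqrt (∑ i, ((x i : ℝ)) ^ 2)

/-- The box `Λ_N = {−N,…,N}^d ⊂ ℤ^d`. -/
def box (d N : ℕ) : Finset (Zd d) := Fintype.piFinset fun _ => Finset.Icc (-(N : ℤ)) (N : ℤ)

/-- The spin value `±1` of a Boolean spin. -/
def spinB (b : Bool) : ℝ := if b then 1 else -1

/-- `−ℋ^+_N(σ)`: the (negated) Hamiltonian in `Λ_N` with plus boundary conditions,
`∑_{{i,j}⊆Λ_N} J(i−j) σ_i σ_j + ∑_{i∈Λ_N} (∑_{j∉Λ_N} J(i−j)) σ_i`.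
(The pair sum is written as half the double sum; the diagonal contributes `0`
because `J(0) = 0`.) -/
def plusEnergy (d N : ℕ) (J : Zd d → ℝ) (σ : {x // x ∈ box d N} → Bool) : ℝ :=
  (1 / 2) * ∑ i : {x // x ∈ box d N}, ∑ j : {x // x ∈ box d N},
      J ((i : Zd d) - (j : Zd d)) * spinB (σ i) * spinB (σ j)
  + ∑ i : {x // x ∈ box d N},
      (∑' j : {y : Zd d // y ∉ box d N}, J ((i : Zd d) - (j : Zd d))) * spinB (σ i)

/-- Boltzmann weight of the plus-boundary-condition Ising measure `μ^+_{Λ_N;β}`. -/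
def plusWeight (d N : ℕ) (β : ℝ) (J : Zd d → ℝ) (σ : {x // x ∈ box d N} → Bool) : ℝ :=
  Real.exp (β * plusEnergy d N J σ)

/-- Expectation under `μ^+_{Λ_N;β}`. -/
def plusExp (d N : ℕ) (β : ℝ) (J : Zd d → ℝ)
    (f : ({x // x ∈ box d N} → Bool) → ℝ) : ℝ :=
  (∑ σ : {x // x ∈ box d N} → Bool, f σ * plusWeight d N β J σ) /
    (∑ σ : {x // x ∈ box d N} → Bool, plusWeight d N β J σ)

/-- The truncated two-point function `⟨σ_u; σ_v⟩ = Cov_{μ^+_{Λ_N;β}}(σ_u, σ_v)`. -/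
def plusCov (d N : ℕ) (β : ℝ) (J : Zd d → ℝ) (u v : Zd d)
    (hu : u ∈ box d N) (hv : v ∈ box d N) : ℝ :=
  plusExp d N β J (fun σ => spinB (σ ⟨u, hu⟩) * spinB (σ ⟨v, hv⟩))
    - plusExp d N β J (fun σ => spinB (σ ⟨u, hu⟩)) *
        plusExp d N β J (fun σ => spinB (σ ⟨v, hv⟩))

/-- The Green function of the killed random walk with killing parameter `λ`:
`G^{KRW}_λ(0,x) = ∑_{n≥1} ∑_{γ : 0 → x edge self-avoiding, |γ|=n} ∏_{i=1}^n λ J(γ_i−γ_{i−1})`,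
valued in `[0,∞]`. -/
def Gkrw (d : ℕ) (lam : ℝ) (J : Zd d → ℝ) (x : Zd d) : ℝ≥0∞ :=
  ∑' n : ℕ, ∑' γ : Fin (n + 1) → Zd d,
    if 1 ≤ n ∧ γ 0 = 0 ∧ γ (Fin.last n) = x ∧
        (∀ i j : Fin n, s(γ i.castSucc, γ i.succ) = s(γ j.castSucc, γ j.succ) → i = j)
    then ENNReal.ofReal (∏ i : Fin n, lam * J (γ i.succ - γ i.castSucc)) else 0

namespace PlusCov

section Ferromagnet

variable {V E : Type*}

/-- A pair of spin configurations (two replicas). -/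
abbrev Replicas (V : Type*) := (V → Bool) × (V → Bool)

/-- The spin at a vertex, the ghost vertex `none` carrying the spin `+1`. -/
def ghostSpin (σ : V → Bool) : Option V → ℝ
  | none => 1
  | some i => spinB (σ i)

theorem ghostSpin_eq (σ : V → Bool) (o : Option V) : ghostSpin σ o = 1 ∨ ghostSpin σ o = -1 := by
  cases o with
  | none => exact Or.inl rfl
  | some i => cases h : σ i <;> simp [ghostSpin, spinB, h]

variable (a b : E → Option V) (K : E → ℝ)

/-- The interaction `σ_{a e} σ_{b e}` along the bond `e`. -/
def bond (e : E) (σ : V → Bool) : ℝ := ghostSpin σ (a e) * ghostSpin σ (b e)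

/-- The joint Boltzmann factor of the bond `e` in two replicas. -/
def pairFactor (e : E) (ω : Replicas V) : ℝ :=
  Real.exp (K e * bond a b e ω.1) * Real.exp (K e * bond a b e ω.2)

variable {a b K}

theorem bond_eq (e : E) (σ : V → Bool) : bond a b e σ = 1 ∨ bond a b e σ = -1 := by
  rcases ghostSpin_eq σ (a e) with h | h <;> rcases ghostSpin_eq σ (b e) with h' | h' <;>
    simp [bond, h, h']

theorem bond_sq (e : E) (σ : V → Bool) : bond a b e σ ^ 2 = 1 := by
  rcases bond_eq (a := a) (b := b) e σ with h | h <;> simp [h]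

theorem abs_bond (e : E) (σ : V → Bool) : |bond a b e σ| = 1 := by
  rcases bond_eq (a := a) (b := b) e σ with h | h <;> simp [h]

theorem exp_mul_bond (k : ℝ) (e : E) (σ : V → Bool) :
    Real.exp (k * bond a b e σ) = Real.cosh k + Real.sinh k * bond a b e σ := by
  rcases bond_eq (a := a) (b := b) e σ with h | h
  · simp [h, Real.cosh_add_sinh]
  · simp only [h, mul_neg, mul_one, ← Real.cosh_sub_sinh]; ring

theorem pairFactor_eq (e : E) : pairFactor a b K e = fun ω =>
    (Real.cosh (K e) + Real.sinh (K e) * bond a b e ω.1) *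
      (Real.cosh (K e) + Real.sinh (K e) * bond a b e ω.2) := by
  ext ω
  rw [pairFactor, exp_mul_bond, exp_mul_bond]

/-- Functions of two replicas that are combinations of monomials in the spins with nonnegative
coefficients. -/
inductive SpinPos [Fintype V] : (Replicas V → ℝ) → Prop
  | monomial (c : ℝ) (hc : 0 ≤ c) (m n : V → ℕ) :
      SpinPos fun ω => c * ((∏ i, spinB (ω.1 i) ^ m i) * ∏ i, spinB (ω.2 i) ^ n i)
  | add {f g : Replicas V → ℝ} : SpinPos f → SpinPos g → SpinPos (f + g)

variable [Fintype V]

namespace SpinPos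

theorem mul {f g : Replicas V → ℝ} (hf : SpinPos f) (hg : SpinPos g) : SpinPos (f * g) := by
  induction hf with
  | monomial c hc a b =>
    induction hg with
    | monomial c' hc' a' b' =>
      convert SpinPos.monomial (V := V) (c * c') (mul_nonneg hc hc') (a + a') (b + b') using 1
      ext ω
      simp only [Pi.mul_apply, Pi.add_apply, pow_add, Finset.prod_mul_distrib]
      ring
    | add _ _ h₁ h₂ => rw [mul_add]; exact h₁.add h₂
  | add _ _ h₁ h₂ => rw [add_mul]; exact h₁.add h₂

theorem const {c : ℝ} (hc : 0 ≤ c) : SpinPos (fun _ : Replicas V => c) := by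
  simpa using SpinPos.monomial (V := V) c hc 0 0

theorem one : SpinPos (1 : Replicas V → ℝ) := const zero_le_one

theorem zero : SpinPos (0 : Replicas V → ℝ) := const le_rfl

theorem ghostSpin_fst (o : Option V) : SpinPos fun ω : Replicas V => ghostSpin ω.1 o := by
  cases o with
  | none => exact one
  | some j =>
    classical
    convert SpinPos.monomial (V := V) 1 zero_le_one (Pi.single j 1) 0 using 1
    ext ω
    simp [ghostSpin, Pi.single_apply, pow_ite]

theorem ghostSpin_snd (o : Option V) : SpinPos fun ω : Replicas V => ghostSpin ω.2 o := by
  cases o with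
  | none => exact one
  | some j =>
    classical
    convert SpinPos.monomial (V := V) 1 zero_le_one 0 (Pi.single j 1) using 1
    ext ω
    simp [ghostSpin, Pi.single_apply, pow_ite]

theorem prod {ι : Type*} (s : Finset ι) {f : ι → Replicas V → ℝ} (hf : ∀ i ∈ s, SpinPos (f i)) :
    SpinPos (∏ i ∈ s, f i) :=
  Finset.prod_induction f SpinPos (fun _ _ => mul) one hf

theorem prod_sub_prod {ι : Type*} (s : Finset ι) {f g : ι → Replicas V → ℝ}
    (hf : ∀ i, SpinPos (f i)) (hg : ∀ i, SpinPos (g i)) (h : ∀ i, SpinPos (g i - f i)) :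
    SpinPos (∏ i ∈ s, g i - ∏ i ∈ s, f i) := by
  classical
  induction s using Finset.induction_on with
  | empty => simpa using zero
  | insert j s hj ih =>
    rw [Finset.prod_insert hj, Finset.prod_insert hj]
    have : g j * ∏ i ∈ s, g i - f j * ∏ i ∈ s, f i
        = (g j - f j) * ∏ i ∈ s, g i + f j * (∏ i ∈ s, g i - ∏ i ∈ s, f i) := by ring
    rw [this]
    exact ((h j).mul (prod s fun i _ => hg i)).add ((hf j).mul ih)

theorem sum_prod_spinB_pow_nonneg [DecidableEq V] (a : V → ℕ) :
    0 ≤ ∑ σ : V → Bool, ∏ i, spinB (σ i) ^ a i := by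
  have h := Finset.prod_univ_sum (fun _ : V => (Finset.univ : Finset Bool))
    (fun i b => spinB b ^ a i)
  rw [Fintype.piFinset_univ] at h
  rw [← h]
  refine Finset.prod_nonneg fun i _ => ?_
  rcases Nat.even_or_odd (a i) with h | h <;> simp [spinB, h.neg_one_pow]

theorem sum_nonneg [DecidableEq V] {f : Replicas V → ℝ} (hf : SpinPos f) : 0 ≤ ∑ ω, f ω := by
  induction hf with
  | monomial c hc a b =>
    rw [← Finset.mul_sum, Fintype.sum_prod_type]
    simp only
    rw [← Finset.sum_mul_sum]
    exact mul_nonneg hc (mul_nonneg (sum_prod_spinB_pow_nonneg a) (sum_prod_spinB_pow_nonneg b))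
  | add _ _ h₁ h₂ => simpa [Finset.sum_add_distrib] using add_nonneg h₁ h₂

end SpinPos

namespace SpinPos

theorem bond_fst (e : E) : SpinPos fun ω : Replicas V => bond a b e ω.1 :=
  (ghostSpin_fst (a e)).mul (ghostSpin_fst (b e))

theorem bond_snd (e : E) : SpinPos fun ω : Replicas V => bond a b e ω.2 :=
  (ghostSpin_snd (a e)).mul (ghostSpin_snd (b e))

/-- Nonnegative combinations of `1`, `q + q'` and `q q'` are positive, for `q`, `q'` the two
replicas of a bond. -/
theorem of_bond (e : E) {x y z : ℝ} (hx : 0 ≤ x) (hy : 0 ≤ y) (hz : 0 ≤ z) :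
    SpinPos fun ω : Replicas V => x + y * (bond a b e ω.1 + bond a b e ω.2)
      + z * (bond a b e ω.1 * bond a b e ω.2) :=
  ((const hx).add ((const hy).mul ((bond_fst e).add (bond_snd e)))).add
    ((const hz).mul ((bond_fst e).mul (bond_snd e)))

theorem pairFactor (hK : ∀ e, 0 ≤ K e) (e : E) : SpinPos (pairFactor a b K e) := by
  have hC := (Real.cosh_pos (K e)).le
  have hS := Real.sinh_nonneg_iff.2 (hK e)
  convert of_bond (a := a) (b := b) e (mul_nonneg hC hC) (mul_nonneg hC hS)
    (mul_nonneg hS hS) using 1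
  rw [pairFactor_eq]
  ext ω
  ring

theorem pairFactor_sub_one (hK : ∀ e, 0 ≤ K e) (e : E) :
    SpinPos (PlusCov.pairFactor a b K e - 1) := by
  have hC := (Real.cosh_pos (K e)).le
  have hS := Real.sinh_nonneg_iff.2 (hK e)
  convert of_bond (a := a) (b := b) e (mul_nonneg hS hS) (mul_nonneg hC hS)
    (mul_nonneg hS hS) using 1
  rw [pairFactor_eq]
  ext ω
  simp only [Pi.sub_apply, Pi.one_apply]
  linear_combination Real.cosh_sq (K e)

theorem openFactor_dominated (hK : ∀ e, 0 ≤ K e) (e : E) :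
    SpinPos ((fun ω => K e * (bond a b e ω.1 + bond a b e ω.2)) * PlusCov.pairFactor a b K e
      - (PlusCov.pairFactor a b K e - 1)) := by
  set C := Real.cosh (K e) with hCdef
  set S := Real.sinh (K e) with hSdef
  have hC : 0 ≤ C := (Real.cosh_pos (K e)).le
  have hS : 0 ≤ S := Real.sinh_nonneg_iff.2 (hK e)
  have hSC : S ≤ K e * C := by
    have h : MonotoneOn (fun t => t * Real.cosh t - Real.sinh t) (Set.Ici 0) := by
      refine monotoneOn_of_deriv_nonneg (convex_Ici 0) (by fun_prop) (by fun_prop) fun t ht => ?_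
      have hd : HasDerivAt (fun t => t * Real.cosh t - Real.sinh t)
          (1 * Real.cosh t + t * Real.sinh t - Real.cosh t) t :=
        ((hasDerivAt_id t).mul (Real.hasDerivAt_cosh t)).sub (Real.hasDerivAt_sinh t)
      rw [interior_Ici] at ht
      have ht' : (0 : ℝ) < t := ht
      rw [hd.deriv]
      have := mul_nonneg ht'.le (Real.sinh_nonneg_iff.2 ht'.le)
      linarith
    have := h (Set.mem_Ici.2 le_rfl) (Set.mem_Ici.2 (hK e)) (hK e)
    simp only [zero_mul, Real.sinh_zero, sub_zero] at this
    linarith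
  have h₁ : 0 ≤ 2 * K e * C * S - S * S := by
    nlinarith [mul_nonneg (mul_nonneg (hK e) hC) hS]
  have h₂ : 0 ≤ K e * (C * C + S * S) - C * S := by
    nlinarith [mul_nonneg (hK e) (mul_nonneg hS hS)]
  convert of_bond (a := a) (b := b) e h₁ h₂ h₁ using 1
  rw [pairFactor_eq]
  ext ω
  have hq := bond_sq (a := a) (b := b) e ω.1
  have hq' := bond_sq (a := a) (b := b) e ω.2
  simp only [Pi.sub_apply, Pi.mul_apply, Pi.one_apply, ← hCdef, ← hSdef]
  have hcs : C ^ 2 = S ^ 2 + 1 := Real.cosh_sq (K e)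
  set q := bond a b e ω.1
  set q' := bond a b e ω.2
  linear_combination (K e * C * S + K e * S ^ 2 * q') * hq + (K e * C * S + K e * S ^ 2 * q) * hq'
    - hcs

theorem one_dominated (hK : ∀ e, 0 ≤ K e) (e : E) :
    SpinPos ((fun _ => (Real.cosh (K e))⁻¹ ^ 2) * PlusCov.pairFactor a b K e - 1) := by
  have hC := Real.cosh_pos (K e)
  have hS := Real.sinh_nonneg_iff.2 (hK e)
  have ht : 0 ≤ (Real.cosh (K e))⁻¹ * Real.sinh (K e) := mul_nonneg (inv_nonneg.2 hC.le) hS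
  convert of_bond (a := a) (b := b) e le_rfl ht (mul_nonneg ht ht) using 1
  rw [pairFactor_eq]
  ext ω
  simp only [Pi.sub_apply, Pi.mul_apply, Pi.one_apply]
  field_simp
  ring

end SpinPos

end Ferromagnet

section Ferromagnet
variable {V E : Type*} {a b : E → Option V} {K : E → ℝ}

/-- Two vertices are linked when they are the endpoints of a bond of `O`. -/
def Linked (a b : E → Option V) (O : Finset E) (u v : Option V) : Prop :=
  ∃ e ∈ O, (a e = u ∧ b e = v) ∨ (a e = v ∧ b e = u)

/-- The weight of the set `O` of open bonds in two replicas. -/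
def openWeight (a b : E → Option V) (K : E → ℝ) (O : Finset E) (ω : Replicas V) : ℝ :=
  ∏ e ∈ O, (pairFactor a b K e ω - 1)

theorem pairFactor_sub_one_eq_zero {e : E} {ω : Replicas V}
    (h : bond a b e ω.1 ≠ bond a b e ω.2) : pairFactor a b K e ω - 1 = 0 := by
  rcases bond_eq (a := a) (b := b) e ω.1 with h₁ | h₁ <;>
    rcases bond_eq (a := a) (b := b) e ω.2 with h₂ | h₂ <;>
    simp_all [pairFactor, ← Real.exp_add]

theorem ghostSpin_ne_zero (σ : V → Bool) (o : Option V) : ghostSpin σ o ≠ 0 := by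
  rcases ghostSpin_eq σ o with h | h <;> simp [h]

theorem agree_iff_of_openWeight_ne_zero {O : Finset E} {ω : Replicas V} {u v : Option V}
    (h : openWeight a b K O ω ≠ 0) (huv : Relation.ReflTransGen (Linked a b O) u v) :
    ghostSpin ω.1 u = ghostSpin ω.2 u ↔ ghostSpin ω.1 v = ghostSpin ω.2 v := by
  have key : ∀ e ∈ O, (ghostSpin ω.1 (a e) = ghostSpin ω.2 (a e) ↔
      ghostSpin ω.1 (b e) = ghostSpin ω.2 (b e)) := by
    intro e he
    have hb : bond a b e ω.1 = bond a b e ω.2 := by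
      by_contra hne
      exact h (Finset.prod_eq_zero he (pairFactor_sub_one_eq_zero hne))
    unfold bond at hb
    exact ⟨fun h' => mul_left_cancel₀ (ghostSpin_ne_zero _ _) (h' ▸ hb),
      fun h' => mul_right_cancel₀ (ghostSpin_ne_zero _ _) (h' ▸ hb)⟩
  induction huv with
  | refl => rfl
  | tail _ hl ih =>
    obtain ⟨e, he, ⟨h₁, h₂⟩ | ⟨h₁, h₂⟩⟩ := hl
    · exact ih.trans (by rw [← h₁, ← h₂]; exact key e he)
    · exact ih.trans (by rw [← h₁, ← h₂]; exact (key e he).symm)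

open Classical in
/-- Exchange the two replicas on the set `C`. -/
def swapOn (C : Set (Option V)) (ω : Replicas V) : Replicas V :=
  (fun i => if some i ∈ C then ω.2 i else ω.1 i, fun i => if some i ∈ C then ω.1 i else ω.2 i)

theorem swapOn_involutive (C : Set (Option V)) : Function.Involutive (swapOn C) := by
  intro ω
  ext i <;> by_cases h : some i ∈ C <;> simp [swapOn, h]

theorem ghostSpin_swapOn_of_mem {C : Set (Option V)} (hC : none ∉ C) (ω : Replicas V)
    {o : Option V} (ho : o ∈ C) : ghostSpin (swapOn C ω).1 o = ghostSpin ω.2 o ∧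
      ghostSpin (swapOn C ω).2 o = ghostSpin ω.1 o := by
  cases o with
  | none => exact absurd ho hC
  | some i => simp [swapOn, ghostSpin, ho]

theorem ghostSpin_swapOn_of_notMem {C : Set (Option V)} (ω : Replicas V)
    {o : Option V} (ho : o ∉ C) : ghostSpin (swapOn C ω).1 o = ghostSpin ω.1 o ∧
      ghostSpin (swapOn C ω).2 o = ghostSpin ω.2 o := by
  cases o with
  | none => exact ⟨rfl, rfl⟩
  | some i => simp [swapOn, ghostSpin, ho]

theorem openWeight_swapOn {C : Set (Option V)} (hC : none ∉ C) {O : Finset E}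
    (h : ∀ e ∈ O, a e ∈ C ↔ b e ∈ C) (ω : Replicas V) :
    openWeight a b K O (swapOn C ω) = openWeight a b K O ω := by
  refine Finset.prod_congr rfl fun e he => ?_
  unfold pairFactor bond
  by_cases hb : b e ∈ C
  · have ha := (h e he).2 hb
    rw [(ghostSpin_swapOn_of_mem hC ω ha).1, (ghostSpin_swapOn_of_mem hC ω ha).2,
      (ghostSpin_swapOn_of_mem hC ω hb).1, (ghostSpin_swapOn_of_mem hC ω hb).2]
    ring
  · have ha : a e ∉ C := fun ha => hb ((h e he).1 ha)
    rw [(ghostSpin_swapOn_of_notMem ω ha).1, (ghostSpin_swapOn_of_notMem ω ha).2,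
      (ghostSpin_swapOn_of_notMem ω hb).1, (ghostSpin_swapOn_of_notMem ω hb).2]

variable [Fintype V]

theorem spinPos_openWeight (hK : ∀ e, 0 ≤ K e) (O : Finset E) :
    SpinPos (openWeight a b K O) := by
  have := SpinPos.prod O fun e _ => SpinPos.pairFactor_sub_one (a := a) (b := b) hK e
  convert this using 1
  ext ω
  simp [openWeight]

theorem spinPos_source (x y : V) : SpinPos fun ω : Replicas V =>
    spinB (ω.1 x) * spinB (ω.1 y) + spinB (ω.2 x) * spinB (ω.2 y) :=
  ((SpinPos.ghostSpin_fst (some x)).mul (SpinPos.ghostSpin_fst (some y))).add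
    ((SpinPos.ghostSpin_snd (some x)).mul (SpinPos.ghostSpin_snd (some y)))

variable [DecidableEq V]

theorem sum_diff_mul_openWeight_eq_zero {O : Finset E} {x y : V}
    (h : ¬(Relation.ReflTransGen (Linked a b O) (some x) (some y) ∧
      ¬ Relation.ReflTransGen (Linked a b O) (some x) none)) :
    ∑ ω : Replicas V, (spinB (ω.1 x) - spinB (ω.2 x)) * (spinB (ω.1 y) - spinB (ω.2 y)) *
      openWeight a b K O ω = 0 := by
  by_cases hg : Relation.ReflTransGen (Linked a b O) (some x) none
  · refine Finset.sum_eq_zero fun ω _ => ?_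
    by_cases hw : openWeight a b K O ω = 0
    · rw [hw, mul_zero]
    · have : spinB (ω.1 x) = spinB (ω.2 x) := (agree_iff_of_openWeight_ne_zero hw hg).2 rfl
      rw [this, sub_self, zero_mul, zero_mul]
  · have hxy : ¬ Relation.ReflTransGen (Linked a b O) (some x) (some y) := fun hxy => h ⟨hxy, hg⟩
    set C : Set (Option V) := {o | Relation.ReflTransGen (Linked a b O) (some x) o}
    have hC : ∀ e ∈ O, a e ∈ C ↔ b e ∈ C := fun e he =>
      ⟨fun h => h.tail ⟨e, he, Or.inl ⟨rfl, rfl⟩⟩, fun h => h.tail ⟨e, he, Or.inr ⟨rfl, rfl⟩⟩⟩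
    have hx : some x ∈ C := Relation.ReflTransGen.refl
    have hgC : none ∉ C := hg
    have hsum := Equiv.sum_comp (swapOn_involutive C).toPerm fun ω : Replicas V =>
      (spinB (ω.1 x) - spinB (ω.2 x)) * (spinB (ω.1 y) - spinB (ω.2 y)) * openWeight a b K O ω
    have hneg : ∀ ω : Replicas V, (spinB ((swapOn C ω).1 x) - spinB ((swapOn C ω).2 x)) *
        (spinB ((swapOn C ω).1 y) - spinB ((swapOn C ω).2 y)) * openWeight a b K O (swapOn C ω)
        = -((spinB (ω.1 x) - spinB (ω.2 x)) * (spinB (ω.1 y) - spinB (ω.2 y)) *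
          openWeight a b K O ω) := by
      intro ω
      rw [openWeight_swapOn hgC hC]
      have h₁ := ghostSpin_swapOn_of_mem hgC ω hx
      have h₂ := ghostSpin_swapOn_of_notMem ω (show some y ∉ C from hxy)
      simp only [ghostSpin] at h₁ h₂
      rw [h₁.1, h₁.2, h₂.1, h₂.2]
      ring
    simp only [Function.Involutive.coe_toPerm, hneg, Finset.sum_neg_distrib] at hsum
    linarith

/-- The weight of `O` with a source at `x` and `y` in either replica. -/
def sourceWeight (a b : E → Option V) (K : E → ℝ) (x y : V) (O : Finset E) : ℝ :=
  ∑ ω : Replicas V, (spinB (ω.1 x) * spinB (ω.1 y) + spinB (ω.2 x) * spinB (ω.2 y)) *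
    openWeight a b K O ω

theorem sourceWeight_nonneg (hK : ∀ e, 0 ≤ K e) (x y : V) (O : Finset E) :
    0 ≤ sourceWeight a b K x y O :=
  ((spinPos_source x y).mul (spinPos_openWeight hK O)).sum_nonneg

theorem sum_diff_mul_openWeight_le (hK : ∀ e, 0 ≤ K e) (x y : V) (O : Finset E) :
    ∑ ω : Replicas V, (spinB (ω.1 x) - spinB (ω.2 x)) * (spinB (ω.1 y) - spinB (ω.2 y)) *
      openWeight a b K O ω ≤ sourceWeight a b K x y O := by
  have hcross : SpinPos fun ω : Replicas V =>
      spinB (ω.1 x) * spinB (ω.2 y) + spinB (ω.2 x) * spinB (ω.1 y) :=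
    ((SpinPos.ghostSpin_fst (some x)).mul (SpinPos.ghostSpin_snd (some y))).add
      ((SpinPos.ghostSpin_snd (some x)).mul (SpinPos.ghostSpin_fst (some y)))
  have h := (hcross.mul (spinPos_openWeight (a := a) (b := b) hK O)).sum_nonneg
  rw [← sub_nonneg, sourceWeight, ← Finset.sum_sub_distrib]
  convert h using 2 with ω
  simp only [Pi.mul_apply]
  ring

variable [Fintype E] [DecidableEq E]

theorem sum_sourceWeight_le (hK : ∀ e, 0 ≤ K e) (x y : V) (P F : Finset E) :
    ∑ O : Finset E with P ⊆ O ∧ Disjoint F O, sourceWeight a b K x y O ≤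
      2 * ((∏ e ∈ P, 2 * K e) * ∏ e ∈ F, (Real.cosh (K e))⁻¹ ^ 2) *
        ∑ ω : Replicas V, ∏ e, pairFactor a b K e ω := by
  set A : E → Replicas V → ℝ := fun e => if e ∈ F then 0 else pairFactor a b K e - 1 with hA
  set B : E → Replicas V → ℝ := fun e => if e ∈ P then 0 else 1 with hB
  set U : E → Replicas V → ℝ := fun e =>
    (if e ∈ P then fun ω => K e * (bond a b e ω.1 + bond a b e ω.2) else (1 : Replicas V → ℝ)) *
      (if e ∈ F then fun _ => (Real.cosh (K e))⁻¹ ^ 2 else (1 : Replicas V → ℝ)) *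
        pairFactor a b K e with hU
  have hc : ∀ e, SpinPos (fun _ : Replicas V => (Real.cosh (K e))⁻¹ ^ 2) := fun e =>
    SpinPos.const (by positivity)
  have hp : ∀ e, SpinPos fun ω : Replicas V => K e * (bond a b e ω.1 + bond a b e ω.2) := fun e =>
    (SpinPos.const (hK e)).mul ((SpinPos.bond_fst e).add (SpinPos.bond_snd e))
  have hApos : ∀ e, SpinPos (A e) := fun e => by
    simp only [hA]; split_ifs
    · exact SpinPos.zero
    · exact SpinPos.pairFactor_sub_one hK e
  have hBpos : ∀ e, SpinPos (B e) := fun e => by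
    simp only [hB]; split_ifs
    · exact SpinPos.zero
    · exact SpinPos.one
  have hUpos : ∀ e, SpinPos (U e) := fun e => by
    refine (SpinPos.mul ?_ ?_).mul (SpinPos.pairFactor hK e)
    · split_ifs
      · exact hp e
      · exact SpinPos.one
    · split_ifs
      · exact hc e
      · exact SpinPos.one
  have hdom : ∀ e, SpinPos (U e - (A e + B e)) := fun e => by
    by_cases hP : e ∈ P <;> by_cases hF : e ∈ F
    · simpa [hA, hB, hP, hF] using hUpos e
    · simpa [hA, hB, hU, hP, hF] using SpinPos.openFactor_dominated (a := a) (b := b) hK e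
    · simpa [hA, hB, hU, hP, hF] using SpinPos.one_dominated (a := a) (b := b) hK e
    · simpa [hA, hB, hU, hP, hF] using SpinPos.zero
  have hexp : ∀ ω, ∑ O : Finset E with P ⊆ O ∧ Disjoint F O, openWeight a b K O ω
      = (∏ e, (A e + B e)) ω := by
    intro ω
    rw [Finset.prod_add, Finset.sum_apply, Finset.powerset_univ, Finset.sum_filter]
    refine Finset.sum_congr rfl fun O _ => ?_
    rw [Pi.mul_apply, Finset.prod_apply, Finset.prod_apply]
    split_ifs with h
    · rw [Finset.prod_eq_one (s := Finset.univ \ O), mul_one]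
      · refine Finset.prod_congr rfl fun e he => ?_
        simp [hA, Finset.disjoint_right.1 h.2 he]
      · intro e he
        have : e ∉ P := fun hP => (Finset.mem_sdiff.1 he).2 (h.1 hP)
        simp [hB, this]
    · rw [not_and_or] at h
      rcases h with h | h
      · obtain ⟨e, he, heO⟩ := Finset.not_subset.1 h
        rw [Finset.prod_eq_zero (s := Finset.univ \ O) (i := e), mul_zero] <;> simp [hB, he, heO]
      · obtain ⟨e, he, heO⟩ := Finset.not_disjoint_iff.1 h
        rw [Finset.prod_eq_zero (s := O) (i := e), zero_mul] <;> simp [hA, he, heO]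
  have hle : ∑ O : Finset E with P ⊆ O ∧ Disjoint F O, sourceWeight a b K x y O ≤
      ∑ ω : Replicas V, (spinB (ω.1 x) * spinB (ω.1 y) + spinB (ω.2 x) * spinB (ω.2 y)) *
        (∏ e, U e) ω := by
    have h := ((spinPos_source x y).mul (SpinPos.prod_sub_prod Finset.univ
      (fun e => (hApos e).add (hBpos e)) hUpos hdom)).sum_nonneg
    simp only [Pi.mul_apply, Pi.sub_apply, mul_sub, Finset.sum_sub_distrib, sub_nonneg] at h
    refine le_trans (le_of_eq ?_) h
    unfold sourceWeight
    rw [Finset.sum_comm]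
    simp_rw [← Finset.mul_sum, hexp]
  refine hle.trans ?_
  rw [Finset.mul_sum]
  refine Finset.sum_le_sum fun ω _ => ?_
  have hUω : (∏ e, U e) ω = (∏ e ∈ P, K e * (bond a b e ω.1 + bond a b e ω.2)) *
      (∏ e ∈ F, (Real.cosh (K e))⁻¹ ^ 2) * ∏ e, pairFactor a b K e ω := by
    have h : ∀ e, U e ω = (if e ∈ P then K e * (bond a b e ω.1 + bond a b e ω.2) else 1) *
        (if e ∈ F then (Real.cosh (K e))⁻¹ ^ 2 else 1) * pairFactor a b K e ω := fun e => by
      simp only [hU, Pi.mul_apply]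
      split_ifs <;> rfl
    rw [Finset.prod_apply, Finset.prod_congr rfl fun e _ => h e, Finset.prod_mul_distrib,
      Finset.prod_mul_distrib, Finset.prod_ite_mem, Finset.prod_ite_mem, Finset.univ_inter,
      Finset.univ_inter]
  rw [hUω, ← mul_assoc]
  refine mul_le_mul_of_nonneg_right ?_ (Finset.prod_nonneg fun e _ => by
    unfold pairFactor; positivity)
  rw [← mul_assoc, ← mul_assoc]
  refine mul_le_mul_of_nonneg_right ?_ (Finset.prod_nonneg fun e _ => by positivity)
  refine (le_abs_self _).trans ?_
  rw [abs_mul]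
  have hs : ∀ t : Bool, |spinB t| = 1 := fun t => by cases t <;> simp [spinB]
  refine mul_le_mul ?_ ?_ (abs_nonneg _) zero_le_two
  · refine (abs_add_le _ _).trans ?_
    rw [abs_mul, abs_mul, hs, hs, hs, hs]; norm_num
  · rw [Finset.abs_prod]
    refine Finset.prod_le_prod (fun e _ => abs_nonneg _) fun e _ => ?_
    rw [abs_mul, abs_of_nonneg (hK e), mul_comm]
    refine mul_le_mul_of_nonneg_right ((abs_add_le _ _).trans ?_) (hK e)
    rw [abs_bond, abs_bond]; norm_num

open Classical in
/-- The covariance of two spins is bounded by the total weight of the open sets connecting them but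
not connected to the ghost. -/
theorem covariance_le (hK : ∀ e, 0 ≤ K e) (x y : V) :
    ∃ c : Finset E → ℝ, (∀ O, 0 ≤ c O) ∧
      (∀ w : (V → Bool) → ℝ, (∀ σ, w σ = ∏ e, Real.exp (K e * bond a b e σ)) →
        (∑ σ, spinB (σ x) * spinB (σ y) * w σ) / (∑ σ, w σ)
          - (∑ σ, spinB (σ x) * w σ) / (∑ σ, w σ) * ((∑ σ, spinB (σ y) * w σ) / (∑ σ, w σ)) ≤
        ∑ O : Finset E, if Relation.ReflTransGen (Linked a b O) (some x) (some y) ∧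
          ¬ Relation.ReflTransGen (Linked a b O) (some x) none then c O else 0) ∧
      ∀ P F : Finset E, ∑ O : Finset E with P ⊆ O ∧ Disjoint F O, c O ≤
        (∏ e ∈ P, 2 * K e) * ∏ e ∈ F, (Real.cosh (K e))⁻¹ ^ 2 := by
  set Z₂ := ∑ ω : Replicas V, ∏ e, pairFactor a b K e ω with hZ₂
  have hpf : ∀ e (ω : Replicas V), 0 < pairFactor a b K e ω := fun e ω => by
    unfold pairFactor; positivity
  have hZ : 0 < Z₂ := Finset.sum_pos (fun ω _ => Finset.prod_pos fun e _ => hpf e ω)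
    Finset.univ_nonempty
  refine ⟨fun O => sourceWeight a b K x y O / (2 * Z₂), fun O => ?_, ?_, ?_⟩
  · exact div_nonneg (sourceWeight_nonneg hK x y O) (by positivity)
  · intro w hw
    have hprod : ∀ ω : Replicas V, ∏ e, pairFactor a b K e ω = w ω.1 * w ω.2 := fun ω => by
      rw [hw, hw, ← Finset.prod_mul_distrib]; rfl
    set Z := ∑ σ, w σ with hZdef
    have hZZ : Z₂ = Z * Z := by
      rw [hZ₂, Fintype.sum_prod_type, hZdef, Finset.sum_mul_sum]
      simp_rw [hprod]
    have hZne : Z ≠ 0 := fun h => by rw [hZZ, h, mul_zero] at hZ; exact lt_irrefl _ hZ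
    have hpair : ∀ f g : (V → Bool) → ℝ,
        ∑ ω : Replicas V, f ω.1 * g ω.2 * (w ω.1 * w ω.2)
          = (∑ σ, f σ * w σ) * ∑ σ, g σ * w σ := by
      intro f g
      rw [Fintype.sum_prod_type, Finset.sum_mul_sum]
      exact Finset.sum_congr rfl fun _ _ => Finset.sum_congr rfl fun _ _ => by ring
    have hcov : ∑ ω : Replicas V, (spinB (ω.1 x) - spinB (ω.2 x)) *
        (spinB (ω.1 y) - spinB (ω.2 y)) * ∏ e, pairFactor a b K e ω
        = 2 * ((∑ σ, spinB (σ x) * spinB (σ y) * w σ) * Z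
          - (∑ σ, spinB (σ x) * w σ) * ∑ σ, spinB (σ y) * w σ) := by
      have h₁ := hpair (fun σ => spinB (σ x) * spinB (σ y)) 1
      have h₂ := hpair 1 (fun σ => spinB (σ x) * spinB (σ y))
      have h₃ := hpair (fun σ => spinB (σ x)) (fun σ => spinB (σ y))
      have h₄ := hpair (fun σ => spinB (σ y)) (fun σ => spinB (σ x))
      simp only [Pi.one_apply, one_mul, mul_one] at h₁ h₂
      rw [← hZdef] at h₁ h₂
      have : ∑ ω : Replicas V, (spinB (ω.1 x) - spinB (ω.2 x)) *
        (spinB (ω.1 y) - spinB (ω.2 y)) * ∏ e, pairFactor a b K e ω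
        = ∑ ω : Replicas V, spinB (ω.1 x) * spinB (ω.1 y) * (w ω.1 * w ω.2)
          + ∑ ω : Replicas V, spinB (ω.2 x) * spinB (ω.2 y) * (w ω.1 * w ω.2)
          - ∑ ω : Replicas V, spinB (ω.1 x) * spinB (ω.2 y) * (w ω.1 * w ω.2)
          - ∑ ω : Replicas V, spinB (ω.1 y) * spinB (ω.2 x) * (w ω.1 * w ω.2) := by
        rw [← Finset.sum_add_distrib, ← Finset.sum_sub_distrib, ← Finset.sum_sub_distrib]
        refine Finset.sum_congr rfl fun ω _ => ?_
        rw [hprod]; ring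
      rw [this, h₁, h₂, h₃, h₄]; ring
    have hopen : ∀ ω : Replicas V, ∏ e, pairFactor a b K e ω
        = ∑ O : Finset E, openWeight a b K O ω := fun ω => by
      have := Finset.prod_one_add (f := fun e => pairFactor a b K e ω - 1) (Finset.univ : Finset E)
      simpa [openWeight] using this
    have hsum : ∑ ω : Replicas V, (spinB (ω.1 x) - spinB (ω.2 x)) *
        (spinB (ω.1 y) - spinB (ω.2 y)) * ∏ e, pairFactor a b K e ω ≤
        ∑ O : Finset E, if Relation.ReflTransGen (Linked a b O) (some x) (some y) ∧
          ¬ Relation.ReflTransGen (Linked a b O) (some x) none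
          then sourceWeight a b K x y O else 0 := by
      simp_rw [hopen, Finset.mul_sum]
      rw [Finset.sum_comm]
      refine Finset.sum_le_sum fun O _ => ?_
      split_ifs with h
      · exact sum_diff_mul_openWeight_le hK x y O
      · exact (sum_diff_mul_openWeight_eq_zero h).le
    have hfinal : (∑ O : Finset E, if Relation.ReflTransGen (Linked a b O) (some x) (some y) ∧
          ¬ Relation.ReflTransGen (Linked a b O) (some x) none
          then sourceWeight a b K x y O / (2 * Z₂) else 0) =
        (∑ O : Finset E, if Relation.ReflTransGen (Linked a b O) (some x) (some y) ∧
          ¬ Relation.ReflTransGen (Linked a b O) (some x) none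
          then sourceWeight a b K x y O else 0) / (2 * Z₂) := by
      rw [Finset.sum_div]
      exact Finset.sum_congr rfl fun O _ => by split_ifs <;> simp
    rw [hfinal, le_div_iff₀ (by positivity)]
    refine le_trans (le_of_eq ?_) hsum
    rw [hcov, hZZ]
    field_simp
  · intro P F
    rw [← Finset.sum_div, div_le_iff₀ (by positivity)]
    refine (sum_sourceWeight_le hK x y P F).trans (le_of_eq ?_)
    ring

end Ferromagnet

section Contours

variable {d : ℕ}

/-- The `k`-th standard unit vector of `ℤ^d`. -/
def unitVec (k : Fin d) : Zd d := Pi.single k 1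

/-- The nearest-neighbour edges of `ℤ^d`: `(y, k)` is the edge from `y` to `y + e_k`. -/
abbrev NNEdge (d : ℕ) := Zd d × Fin d

/-- The edge boundary of a finite set of lattice points. -/
def edgeBdry (I : Finset (Zd d)) : Finset (NNEdge d) :=
  ((I ×ˢ Finset.univ) ∪ (I ×ˢ Finset.univ).image fun p => (p.1 - unitVec p.2, p.2)).filter
    fun p => ¬(p.1 ∈ I ↔ p.1 + unitVec p.2 ∈ I)

theorem mem_edgeBdry {I : Finset (Zd d)} {p : NNEdge d} :
    p ∈ edgeBdry I ↔ ¬(p.1 ∈ I ↔ p.1 + unitVec p.2 ∈ I) := by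
  rw [edgeBdry, Finset.mem_filter, and_iff_right_iff_imp]
  intro h
  rw [Finset.mem_union, Finset.mem_product, Finset.mem_image]
  by_cases hp : p.1 ∈ I
  · exact Or.inl ⟨hp, Finset.mem_univ _⟩
  · refine Or.inr ⟨(p.1 + unitVec p.2, p.2), ?_, by simp⟩
    simp only [Finset.mem_product, Finset.mem_univ, and_true]
    tauto

theorem edgeBdry_symmDiff (I I' : Finset (Zd d)) :
    edgeBdry (symmDiff I I') = symmDiff (edgeBdry I) (edgeBdry I') := by
  ext p
  simp only [Finset.mem_symmDiff, mem_edgeBdry]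
  tauto

/-- A ray in a coordinate direction leaves a finite set through its boundary. -/
theorem exists_edge_mem_edgeBdry_add {I : Finset (Zd d)} {v : Zd d} (hv : v ∈ I) (k : Fin d) :
    ∃ t : ℕ, (v + (t : ℤ) • unitVec k, k) ∈ edgeBdry I := by
  have hinj : Function.Injective fun t : ℕ => v + (t : ℤ) • unitVec k := fun s t h => by
    have := congrFun h k
    simpa [unitVec] using this
  have hex : ∃ t : ℕ, v + (t : ℤ) • unitVec k ∉ I := by
    by_contra! h
    exact Set.infinite_of_injective_forall_mem hinj h I.finite_toSet
  classical
  obtain ⟨s, hs⟩ : ∃ s, Nat.find hex = s + 1 :=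
    Nat.exists_eq_succ_of_ne_zero fun h => Nat.find_spec hex (by rw [h]; simpa using hv)
  refine ⟨s, mem_edgeBdry.2 fun h => ?_⟩
  have h₁ : v + (s : ℤ) • unitVec k ∈ I := by
    by_contra hc
    exact Nat.find_min hex (by omega) hc
  have h₂ := Nat.find_spec hex
  rw [hs] at h₂
  refine h₂ ?_
  have := h.1 h₁
  rwa [add_assoc, ← add_one_zsmul] at this

theorem exists_edge_mem_edgeBdry_sub {I : Finset (Zd d)} {v : Zd d} (hv : v ∈ I) (k : Fin d) :
    ∃ t : ℕ, (v - ((t : ℤ) + 1) • unitVec k, k) ∈ edgeBdry I := by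
  have hinj : Function.Injective fun t : ℕ => v - (t : ℤ) • unitVec k := fun s t h => by
    have := congrFun h k
    simpa [unitVec] using this
  have hex : ∃ t : ℕ, v - (t : ℤ) • unitVec k ∉ I := by
    by_contra! h
    exact Set.infinite_of_injective_forall_mem hinj h I.finite_toSet
  classical
  obtain ⟨s, hs⟩ : ∃ s, Nat.find hex = s + 1 :=
    Nat.exists_eq_succ_of_ne_zero fun h => Nat.find_spec hex (by rw [h]; simpa using hv)
  refine ⟨s, mem_edgeBdry.2 fun h => ?_⟩
  have h₁ : v - (s : ℤ) • unitVec k ∈ I := by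
    by_contra hc
    exact Nat.find_min hex (by omega) hc
  have h₂ := Nat.find_spec hex
  rw [hs] at h₂
  push_cast at h₂
  refine h₂ (h.2 ?_)
  have : v - ((s : ℤ) + 1) • unitVec k + unitVec k = v - (s : ℤ) • unitVec k := by
    rw [add_one_zsmul]; abel
  simpa only [this] using h₁

theorem edgeBdry_injective (k : Fin d) : Function.Injective (edgeBdry (d := d)) := by
  intro I I' h
  have h0 : edgeBdry (symmDiff I I') = ∅ := by rw [edgeBdry_symmDiff, h, symmDiff_self]; rfl
  by_contra hne
  obtain ⟨v, hv⟩ : (symmDiff I I').Nonempty := by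
    rw [Finset.nonempty_iff_ne_empty]
    exact fun h => hne (symmDiff_eq_bot.1 h)
  obtain ⟨t, ht⟩ := exists_edge_mem_edgeBdry_add hv k
  rw [h0] at ht
  exact absurd ht (Finset.notMem_empty _)

/-- The four edges of the unit square at `z` in the directions `i` and `j`. -/
def plaquette (z : Zd d) (i j : Fin d) : Finset (NNEdge d) :=
  {(z, i), (z + unitVec i, j), (z, j), (z + unitVec j, i)}

/-- Two edges are adjacent when they lie on a common plaquette. -/
def PlaqAdj (p q : NNEdge d) : Prop :=
  ∃ z i j, i ≠ j ∧ p ∈ plaquette z i j ∧ q ∈ plaquette z i j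

theorem PlaqAdj.symm {p q : NNEdge d} (h : PlaqAdj p q) : PlaqAdj q p := by
  obtain ⟨z, i, j, hij, hp, hq⟩ := h
  exact ⟨z, i, j, hij, hq, hp⟩

theorem PlaqAdj.sub_mem {p q : NNEdge d} (h : PlaqAdj p q) (k : Fin d) :
    q.1 k - p.1 k ∈ Finset.Icc (-1 : ℤ) 1 := by
  obtain ⟨z, i, j, hij, hp, hq⟩ := h
  simp only [plaquette, Finset.mem_insert, Finset.mem_singleton] at hp hq
  have hu : ∀ l : Fin d, unitVec l k = 0 ∨ unitVec l k = 1 := fun l => by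
    by_cases hl : k = l <;> simp [unitVec, hl]
  rw [Finset.mem_Icc]
  have hi := hu i
  have hj := hu j
  rcases hp with rfl | rfl | rfl | rfl <;> rcases hq with rfl | rfl | rfl | rfl <;>
    simp only [Pi.add_apply] <;> omega

/-- A finite set of lattice points whose boundary is connected for plaquette adjacency. -/
def IsContour (I : Finset (Zd d)) : Prop :=
  ∀ R ⊆ edgeBdry I, R.Nonempty → R ≠ edgeBdry I → ∃ r ∈ R, ∃ f ∈ edgeBdry I, f ∉ R ∧ PlaqAdj r f

open Classical in
/-- The indicator of a set of edges, with values in `ℤ/2ℤ`. -/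
def edgeInd (R : Finset (NNEdge d)) (p : NNEdge d) : ZMod 2 := if p ∈ R then 1 else 0

/-- Any finite closed set of edges is a boundary. -/
theorem exists_edgeBdry_eq {i₀ i₁ : Fin d} (h01 : i₀ ≠ i₁) (R : Finset (NNEdge d))
    (hR : ∀ z i j, i ≠ j → edgeInd R (z, i) + edgeInd R (z + unitVec i, j)
      = edgeInd R (z, j) + edgeInd R (z + unitVec j, i)) :
    ∃ I : Finset (Zd d), edgeBdry I = R := by
  obtain ⟨B, hB⟩ : ∃ B : ℕ, ∀ p ∈ R, ∀ k, |p.1 k| < B := by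
    refine ⟨R.sup (fun p => Finset.univ.sup fun k => (p.1 k).natAbs) + 1, fun p hp k => ?_⟩
    have h₁ : (p.1 k).natAbs ≤ Finset.univ.sup fun k => (p.1 k).natAbs :=
      Finset.le_sup (f := fun k => (p.1 k).natAbs) (Finset.mem_univ k)
    have h₂ := Finset.le_sup (f := fun p : NNEdge d => Finset.univ.sup fun k => (p.1 k).natAbs) hp
    have h₃ := h₁.trans h₂
    rw [Int.abs_eq_natAbs]
    exact_mod_cast Nat.lt_succ_of_le h₃
  have hzero : ∀ (y : Zd d) (i k : Fin d), (B : ℤ) ≤ |y k| → edgeInd R (y, i) = 0 := by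
    intro y i k hy
    rw [edgeInd, if_neg]
    exact fun h => absurd (hB _ h k) (not_lt.2 hy)
  set ψ : ℕ → Zd d → ZMod 2 := fun M x =>
    ∑ t ∈ Finset.range M, edgeInd R (x + (t : ℤ) • unitVec i₀, i₀) with hψ
  set φ : Zd d → ZMod 2 := fun x => ψ ((B : ℤ) - x i₀).toNat x with hφ
  have hψφ : ∀ (x : Zd d) (M : ℕ), (B : ℤ) ≤ x i₀ + M → ψ M x = φ x := by
    intro x M hM
    refine (Finset.sum_subset (Finset.range_subset_range.2 (by omega)) fun t _ ht => ?_).symm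
    refine hzero _ _ i₀ (le_trans ?_ (le_abs_self _))
    simp only [Finset.mem_range, not_lt] at ht
    simp [unitVec]
    omega
  have hd0 : ∀ x, φ x = edgeInd R (x, i₀) + φ (x + unitVec i₀) := by
    intro x
    have hM : (B : ℤ) ≤ x i₀ + (((B : ℤ) - x i₀).toNat : ℕ) := by omega
    rw [← hψφ x (((B : ℤ) - x i₀).toNat + 1) (by push_cast; omega),
      ← hψφ (x + unitVec i₀) (((B : ℤ) - x i₀).toNat) (by simp [unitVec]; omega), hψ]
    simp only
    rw [Finset.sum_range_succ', add_comm]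
    congr 1
    · simp
    · refine Finset.sum_congr rfl fun t _ => ?_
      congr 2
      push_cast
      rw [add_one_zsmul]
      abel
  have hdk : ∀ x k, φ x = edgeInd R (x, k) + φ (x + unitVec k) := by
    intro x k
    by_cases hk : k = i₀
    · rw [hk]; exact hd0 x
    set M := ((B : ℤ) - x i₀).toNat with hMdef
    have hM : (B : ℤ) ≤ x i₀ + (M : ℕ) := by omega
    rw [← hψφ x M hM, ← hψφ (x + unitVec k) M (by simp [unitVec, Ne.symm hk]; omega)]
    have htel := Finset.sum_range_sub (fun t : ℕ => edgeInd R (x + (t : ℤ) • unitVec i₀, k)) M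
    have hend : edgeInd R (x + (M : ℤ) • unitVec i₀, k) = 0 :=
      hzero _ _ i₀ (le_trans (by simp [unitVec]; omega) (le_abs_self _))
    have hsum : ψ M x - ψ M (x + unitVec k) = -∑ t ∈ Finset.range M,
        (edgeInd R (x + ((t + 1 : ℕ) : ℤ) • unitVec i₀, k)
          - edgeInd R (x + (t : ℤ) • unitVec i₀, k)) := by
      rw [hψ]
      simp only
      rw [← Finset.sum_sub_distrib, ← Finset.sum_neg_distrib]
      refine Finset.sum_congr rfl fun t _ => ?_
      have h := hR (x + (t : ℤ) • unitVec i₀) i₀ k (Ne.symm hk)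
      have e₁ : x + (t : ℤ) • unitVec i₀ + unitVec i₀ = x + ((t + 1 : ℕ) : ℤ) • unitVec i₀ := by
        push_cast; rw [add_one_zsmul]; abel
      have e₂ : x + (t : ℤ) • unitVec i₀ + unitVec k = x + unitVec k + (t : ℤ) • unitVec i₀ := by
        abel
      rw [e₁, e₂] at h
      linear_combination h
    rw [htel, hend] at hsum
    simp only [Nat.cast_zero, zero_smul, add_zero] at hsum
    linear_combination hsum
  have hside : ∀ (x : Zd d) (k : Fin d), k ≠ i₀ → (B : ℤ) ≤ |x k| → φ x = 0 := by
    intro x k hk hx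
    refine Finset.sum_eq_zero fun t _ => hzero _ _ k ?_
    simpa [unitVec, hk] using hx
  have hsupp : ∀ (x : Zd d) (k : Fin d), (B : ℤ) ≤ |x k| → φ x = 0 := by
    intro x k hx
    by_cases hk : k = i₀
    swap
    · exact hside x k hk hx
    subst hk
    have hconst : ∀ n : ℕ, φ x = φ (x + (n : ℤ) • unitVec i₁) := by
      intro n
      induction n with
      | zero => simp
      | succ n ih =>
        rw [ih, hdk _ i₁, hzero _ _ k (by simpa [unitVec, h01] using hx), zero_add]
        congr 1
        push_cast
        rw [add_one_zsmul]
        abel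
    rw [hconst ((B : ℤ) - x i₁).toNat]
    refine hside _ i₁ h01.symm (le_trans ?_ (le_abs_self _))
    simp [unitVec]
    omega
  classical
  refine ⟨(box d B).filter fun x => φ x ≠ 0, ?_⟩
  have hmem : ∀ x, x ∈ (box d B).filter (fun x => φ x ≠ 0) ↔ φ x ≠ 0 := by
    intro x
    rw [Finset.mem_filter, and_iff_right_iff_imp]
    intro h
    rw [box, Fintype.mem_piFinset]
    intro k
    by_contra hk
    refine h (hsupp x k ?_)
    rw [Finset.mem_Icc, ← abs_le] at hk
    omega
  ext ⟨y, k⟩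
  rw [mem_edgeBdry, hmem, hmem, hdk y k]
  have hind : (y, k) ∈ R ↔ edgeInd R (y, k) = 1 := by
    unfold edgeInd; split_ifs with h <;> simp [h]
  rw [hind]
  generalize edgeInd R (y, k) = s
  generalize φ (y + unitVec k) = t
  revert s t
  decide

theorem edgeInd_edgeBdry_closed (I : Finset (Zd d)) (z : Zd d) (i j : Fin d) :
    edgeInd (edgeBdry I) (z, i) + edgeInd (edgeBdry I) (z + unitVec i, j)
      = edgeInd (edgeBdry I) (z, j) + edgeInd (edgeBdry I) (z + unitVec j, i) := by
  have hc : z + unitVec j + unitVec i = z + unitVec i + unitVec j := by abel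
  simp only [edgeInd, mem_edgeBdry, hc]
  by_cases h₁ : z ∈ I <;> by_cases h₂ : z + unitVec i ∈ I <;> by_cases h₃ : z + unitVec j ∈ I <;>
    by_cases h₄ : z + unitVec i + unitVec j ∈ I <;> simp [h₁, h₂, h₃, h₄] <;> decide

/-- Every point of a finite set is surrounded by a contour contained in its boundary. -/
theorem exists_isContour {i₀ i₁ : Fin d} (h01 : i₀ ≠ i₁) (S : Finset (Zd d)) {v : Zd d}
    (hv : v ∈ S) : ∃ I : Finset (Zd d), v ∈ I ∧ edgeBdry I ⊆ edgeBdry S ∧ IsContour I := by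
  induction hn : (edgeBdry S).card using Nat.strong_induction_on generalizing S with
  | _ n ih =>
    by_cases hS : IsContour S
    · exact ⟨S, hv, subset_rfl, hS⟩
    unfold IsContour at hS
    push Not at hS
    obtain ⟨R, hRS, hRne, hRneq, hR⟩ := hS
    have hclosed : ∀ z i j, i ≠ j → edgeInd R (z, i) + edgeInd R (z + unitVec i, j)
        = edgeInd R (z, j) + edgeInd R (z + unitVec j, i) := by
      intro z i j hij
      by_cases h : ∃ r ∈ R, r ∈ plaquette z i j
      · obtain ⟨r, hr, hrp⟩ := h
        have heq : ∀ f ∈ plaquette z i j, edgeInd R f = edgeInd (edgeBdry S) f := by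
          intro f hf
          have : f ∈ R ↔ f ∈ edgeBdry S :=
            ⟨fun h => hRS h, fun h => by_contra fun hfR => hR r hr f h hfR ⟨z, i, j, hij, hrp, hf⟩⟩
          simp [edgeInd, this]
        rw [heq, heq, heq, heq, edgeInd_edgeBdry_closed] <;> simp [plaquette]
      · push Not at h
        have heq : ∀ f ∈ plaquette z i j, edgeInd R f = 0 := fun f hf => by
          rw [edgeInd, if_neg fun hfR => h f hfR hf]
        rw [heq, heq, heq, heq] <;> simp [plaquette]
    obtain ⟨I₁, hI₁⟩ := exists_edgeBdry_eq h01 R hclosed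
    by_cases hvI : v ∈ I₁
    · obtain ⟨I, h₁, h₂, h₃⟩ := ih (edgeBdry I₁).card
        (by rw [← hn, hI₁]; exact Finset.card_lt_card (hRS.ssubset_of_ne hRneq)) I₁ hvI rfl
      exact ⟨I, h₁, h₂.trans (hI₁ ▸ hRS), h₃⟩
    · have hb : edgeBdry (symmDiff S I₁) = edgeBdry S \ R := by
        rw [edgeBdry_symmDiff, hI₁, symmDiff_of_ge hRS]
      obtain ⟨I, h₁, h₂, h₃⟩ := ih (edgeBdry (symmDiff S I₁)).card
        (by
          rw [← hn, hb]
          exact Finset.card_lt_card (Finset.sdiff_ssubset hRS hRne)) (symmDiff S I₁)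
        (Finset.mem_symmDiff.2 (Or.inl ⟨hv, hvI⟩)) rfl
      exact ⟨I, h₁, h₂.trans (hb ▸ Finset.sdiff_subset), h₃⟩

end Contours

section Counting

variable {d : ℕ}

/-- The boundary of a contour is covered by a walk of at most twice its length. -/
theorem IsContour.exists_walk {I : Finset (Zd d)} (hI : IsContour I) {e : NNEdge d}
    (he : e ∈ edgeBdry I) : ∃ L : List (NNEdge d), List.IsChain PlaqAdj (e :: L) ∧
      (e :: L).toFinset = edgeBdry I ∧ (e :: L).length ≤ 2 * (edgeBdry I).card := by
  have key : ∀ m : ℕ, m < (edgeBdry I).card → ∃ L : List (NNEdge d),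
      List.IsChain PlaqAdj (e :: L) ∧ (e :: L).toFinset ⊆ edgeBdry I ∧
      m + 1 ≤ (e :: L).toFinset.card ∧ (e :: L).length ≤ 2 * (e :: L).toFinset.card := by
    intro m
    induction m with
    | zero => exact fun _ => ⟨[], by simp, by simpa using he, by simp, by simp⟩
    | succ m ih =>
      intro hm
      obtain ⟨L, h₁, h₂, h₃, h₄⟩ := ih (by omega)
      by_cases hne : (e :: L).toFinset = edgeBdry I
      · exact ⟨L, h₁, h₂, by rw [hne]; omega, h₄⟩
      obtain ⟨r, hr, f, hf, hfR, hadj⟩ := hI _ h₂ ⟨e, by simp⟩ hne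
      obtain ⟨s, t, hst⟩ := List.append_of_mem (List.mem_toFinset.1 hr)
      have hmem : ∀ p, p ∈ s ++ r :: f :: r :: t ↔ p = f ∨ p ∈ e :: L := by
        intro p
        rw [hst]
        simp only [List.mem_append, List.mem_cons]
        tauto
      have hcard : (s ++ r :: f :: r :: t).toFinset = insert f (e :: L).toFinset := by
        ext p
        rw [List.mem_toFinset, hmem, Finset.mem_insert, List.mem_toFinset]
      obtain ⟨L', hL'⟩ : ∃ L', s ++ r :: f :: r :: t = e :: L' := by
        cases s with
        | nil => simp at hst; exact ⟨f :: r :: t, by simp [hst.1]⟩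
        | cons a s => simp at hst; exact ⟨s ++ r :: f :: r :: t, by simp [hst.1]⟩
      have hlen : (e :: L').length = (e :: L).length + 2 := by
        rw [← hL', hst]; simp; ring
      refine ⟨L', ?_, ?_, ?_, ?_⟩
      · rw [hst, List.isChain_split] at h₁
        rw [← hL', List.isChain_split]
        exact ⟨h₁.1, List.isChain_cons_cons.2 ⟨hadj, List.isChain_cons_cons.2 ⟨hadj.symm, h₁.2⟩⟩⟩
      · rw [← hL', hcard]
        exact Finset.insert_subset hf h₂
      · rw [← hL', hcard, Finset.card_insert_of_notMem hfR]; omega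
      · rw [hlen, ← hL', hcard, Finset.card_insert_of_notMem hfR]; omega
  have hpos : 0 < (edgeBdry I).card := Finset.card_pos.2 ⟨e, he⟩
  obtain ⟨L, h₁, h₂, h₃, h₄⟩ := key ((edgeBdry I).card - 1) (by omega)
  have heq := Finset.eq_of_subset_of_card_le h₂ (by omega)
  exact ⟨L, h₁, heq, heq ▸ h₄⟩

/-- Along a walk of edges each coordinate varies by less than the length. -/
theorem abs_sub_lt_length_of_isChain {L : List (NNEdge d)} (hL : L.IsChain PlaqAdj) (k : Fin d) :
    ∀ p ∈ L, ∀ q ∈ L, |q.1 k - p.1 k| < L.length := by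
  have hhead : ∀ (L : List (NNEdge d)) (p : NNEdge d), (p :: L).IsChain PlaqAdj →
      ∀ q ∈ L, |q.1 k - p.1 k| ≤ L.length := by
    intro L
    induction L with
    | nil => simp
    | cons a L ih =>
      intro p hp q hq
      rw [List.isChain_cons_cons] at hp
      have h₁ := Finset.mem_Icc.1 (hp.1.sub_mem k)
      have h₂ : |q.1 k - a.1 k| ≤ L.length := by
        rcases List.mem_cons.1 hq with rfl | hq
        · simp
        · exact ih a hp.2 q hq
      rw [abs_le] at h₂ ⊢
      push_cast [List.length_cons]
      omega
  induction L with
  | nil => simp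
  | cons a L ih =>
    intro p hp q hq
    push_cast [List.length_cons]
    rcases List.mem_cons.1 hp with rfl | hp' <;> rcases List.mem_cons.1 hq with rfl | hq'
    · simp
    · have := hhead L _ hL q hq'
      omega
    · have := hhead L _ hL p hp'
      rw [abs_sub_comm] at this
      omega
    · have := ih hL.tail p hp' q hq'
      omega

/-- The possible steps between adjacent edges: a displacement in `{-1,0,1}^d` and a direction. -/
abbrev EdgeMove (d : ℕ) := (Fin d → Fin 3) × Fin d

/-- The set of edges visited from `p` by a list of moves. -/
def visited (p : NNEdge d) : List (EdgeMove d) → Finset (NNEdge d)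
  | [] => {p}
  | m :: l => insert p (visited (p.1 + fun k => ((m.1 k : ℕ) : ℤ) - 1, m.2) l)

theorem exists_moves_of_isChain (L : List (NNEdge d)) (p : NNEdge d)
    (hL : (p :: L).IsChain PlaqAdj) :
    ∃ l : List (EdgeMove d), l.length = L.length ∧ visited p l = (p :: L).toFinset := by
  induction L generalizing p with
  | nil => exact ⟨[], rfl, by simp [visited]⟩
  | cons q L ih =>
    rw [List.isChain_cons_cons] at hL
    obtain ⟨l, h₁, h₂⟩ := ih q hL.2
    have hstep := fun k => Finset.mem_Icc.1 (hL.1.sub_mem k)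
    refine ⟨(fun k => ⟨(q.1 k - p.1 k + 1).toNat, by have := hstep k; omega⟩, q.2) :: l,
      by simp [h₁], ?_⟩
    have hq : (p.1 + fun k => (((q.1 k - p.1 k + 1).toNat : ℕ) : ℤ) - 1, q.2) = q := by
      refine Prod.ext ?_ rfl
      ext k
      have := hstep k
      simp only [Pi.add_apply]
      omega
    rw [visited, hq, h₂, List.toFinset_cons (a := p)]

/-- The `ℓ¹` norm of a lattice point. -/
def l1Norm (x : Zd d) : ℕ := ∑ k, (x k).natAbs

theorem tsum_geometric_le_two {b : ℝ≥0∞} (hb : 2 * b ≤ 1) : ∑' n : ℕ, b ^ n ≤ 2 := by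
  rw [ENNReal.tsum_geometric, ENNReal.inv_le_iff_inv_le]
  refine ENNReal.le_sub_of_add_le_left ?_ ?_
  · exact ne_top_of_le_ne_top ENNReal.one_ne_top
      (le_trans (by rw [two_mul]; exact le_self_add) hb)
  · have : b ≤ 2⁻¹ := by
      rw [ENNReal.le_inv_iff_mul_le, mul_comm]; exact hb
    exact (add_le_add_left this _).trans (by rw [ENNReal.inv_two_add_inv_two])

theorem tsum_list_pow_le {α : Type*} [Fintype α] {b : ℝ≥0∞}
    (hb : 2 * (b * Fintype.card α) ≤ 1) : ∑' l : List α, b ^ l.length ≤ 2 := by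
  rw [← (List.equivSigmaTuple (α := α)).symm.tsum_eq, ENNReal.tsum_sigma']
  refine le_trans (le_of_eq (tsum_congr fun n => ?_)) (tsum_geometric_le_two hb)
  simp [List.equivSigmaTuple, mul_pow, mul_comm]

open Classical in
/-- Peierls estimate: the total weight of the contours surrounding two given points decays
exponentially. -/
theorem tsum_isContour_le {i₀ : Fin d} {ε μ : ℝ≥0∞} (hμ : 2 * μ ^ d ≤ 1)
    (hM : 2 * (μ ^ d * Fintype.card (EdgeMove d)) ≤ 1) (hε : ε ≤ μ ^ (6 * d)) (v u : Zd d) :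
    ∑' I : Finset (Zd d), (if IsContour I ∧ v ∈ I ∧ u ∈ I then ε ^ (edgeBdry I).card else 0)
      ≤ μ ^ d * μ ^ l1Norm (u - v) := by
  set b := μ ^ d with hb
  set r := Finset.univ.sup fun k => ((u - v) k).natAbs with hr
  have hb1 : b ≤ 1 := le_trans (by rw [two_mul]; exact le_self_add) hμ
  have hμ1 : μ ≤ 1 := by
    by_contra h
    exact absurd hb1 (not_le.2 (one_lt_pow₀ (not_le.1 h) (Fin.pos i₀).ne'))
  set s : Set (Finset (Zd d)) := {I | IsContour I ∧ v ∈ I ∧ u ∈ I} with hs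
  have hexists : ∀ I : s, ∃ tl : ℕ × List (EdgeMove d),
      visited (v + (tl.1 : ℤ) • unitVec i₀, i₀) tl.2 = edgeBdry I.1 ∧
      ε ^ (edgeBdry I.1).card ≤ b ^ r * b ^ 3 * (b ^ tl.1 * b ^ tl.2.length) := by
    rintro ⟨I, hI, hvI, huI⟩
    obtain ⟨t, ht⟩ := exists_edge_mem_edgeBdry_add hvI i₀
    obtain ⟨L, hL₁, hL₂, hL₃⟩ := hI.exists_walk ht
    obtain ⟨l, hl₁, hl₂⟩ := exists_moves_of_isChain _ _ hL₁
    refine ⟨(t, l), hl₂.trans hL₂, ?_⟩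
    have hdist : ∀ k, ∀ p ∈ edgeBdry I, ∀ q ∈ edgeBdry I, |q.1 k - p.1 k| < l.length + 1 := by
      intro k p hp q hq
      rw [← hL₂, List.mem_toFinset] at hp hq
      have := abs_sub_lt_length_of_isChain hL₁ k p hp q hq
      rw [List.length_cons, ← hl₁] at this
      exact_mod_cast this
    have ht' : t ≤ l.length := by
      obtain ⟨t', ht'⟩ := exists_edge_mem_edgeBdry_sub hvI i₀
      have := hdist i₀ _ ht' _ ht
      rw [abs_lt] at this
      simp [unitVec] at this
      omega
    have hr' : r ≤ l.length := by
      refine Finset.sup_le fun k _ => ?_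
      obtain ⟨t₁, h₁⟩ := exists_edge_mem_edgeBdry_add hvI k
      obtain ⟨t₂, h₂⟩ := exists_edge_mem_edgeBdry_sub hvI k
      obtain ⟨t₃, h₃⟩ := exists_edge_mem_edgeBdry_add huI k
      obtain ⟨t₄, h₄⟩ := exists_edge_mem_edgeBdry_sub huI k
      have h₅ := hdist k _ h₂ _ h₃
      have h₆ := hdist k _ h₄ _ h₁
      rw [abs_lt] at h₅ h₆
      simp [unitVec] at h₅ h₆
      rw [Pi.sub_apply]
      omega
    have hlen : l.length + 1 ≤ 2 * (edgeBdry I).card := by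
      rw [List.length_cons, ← hl₁] at hL₃
      exact hL₃
    calc ε ^ (edgeBdry I).card ≤ (μ ^ (6 * d)) ^ (edgeBdry I).card := pow_le_pow_left' hε _
      _ = b ^ (6 * (edgeBdry I).card) := by rw [hb, ← pow_mul, ← pow_mul]; ring_nf
      _ ≤ b ^ (r + 3 + (t + l.length)) := pow_le_pow_right_of_le_one' hb1 (by omega)
      _ = _ := by simp only [pow_add]
  choose g hg₁ hg₂ using hexists
  have hginj : Function.Injective g := by
    intro I I' h
    have h₁ := hg₁ I
    rw [h, hg₁ I'] at h₁
    exact Subtype.ext (edgeBdry_injective i₀ h₁.symm)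
  have htsum : ∑' tl : ℕ × List (EdgeMove d), b ^ r * b ^ 3 * (b ^ tl.1 * b ^ tl.2.length)
      ≤ b ^ r * b ^ 3 * (2 * 2) := by
    rw [ENNReal.tsum_mul_left]
    gcongr
    rw [ENNReal.tsum_prod']
    simp_rw [ENNReal.tsum_mul_left]
    rw [ENNReal.tsum_mul_right]
    refine mul_le_mul' ?_ (tsum_list_pow_le hM)
    exact tsum_geometric_le_two hμ
  have h4 : b ^ 2 * (2 * 2) ≤ 1 := by
    calc b ^ 2 * (2 * 2) = (2 * b) * (2 * b) := by ring
      _ ≤ 1 * 1 := mul_le_mul' hμ hμ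
      _ = 1 := one_mul 1
  have hl1 : l1Norm (u - v) ≤ d * r := by
    have := Finset.sum_le_card_nsmul Finset.univ (fun k => ((u - v) k).natAbs) r
      fun k hk => Finset.le_sup (f := fun k => ((u - v) k).natAbs) hk
    simpa [l1Norm] using this
  calc ∑' I : Finset (Zd d),
        (if IsContour I ∧ v ∈ I ∧ u ∈ I then ε ^ (edgeBdry I).card else 0)
      = ∑' I : s, ε ^ (edgeBdry I.1).card := by
        rw [tsum_subtype s fun I => ε ^ (edgeBdry I).card]
        exact tsum_congr fun I => by simp [Set.indicator_apply, hs]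
    _ ≤ ∑' I : s, b ^ r * b ^ 3 * (b ^ (g I).1 * b ^ (g I).2.length) :=
        ENNReal.tsum_le_tsum hg₂
    _ ≤ _ := ENNReal.tsum_comp_le_tsum_of_injective hginj
        fun tl => b ^ r * b ^ 3 * (b ^ tl.1 * b ^ tl.2.length)
    _ ≤ b ^ r * b ^ 3 * (2 * 2) := htsum
    _ = b * b ^ r * (b ^ 2 * (2 * 2)) := by ring
    _ ≤ b * b ^ r * 1 := by gcongr
    _ ≤ b * μ ^ l1Norm (u - v) := by
        rw [mul_one]
        refine mul_le_mul_right ?_ b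
        rw [hb, ← pow_mul]
        exact pow_le_pow_right_of_le_one' hμ1 hl1

end Counting

section Reach

variable {α : Type*} {R R' : α → α → Prop} {S S' I : Set α}

/-- `Reach R S n v x`: there is an `R`-walk from `v` to `x` inside `S` with at most `n` steps. -/
def Reach (R : α → α → Prop) (S : Set α) : ℕ → α → α → Prop
  | 0, v, x => v ∈ S ∧ v = x
  | n + 1, v, x => v ∈ S ∧ (v = x ∨ ∃ w, R v w ∧ Reach R S n w x)

theorem Reach.start_mem {n : ℕ} {v x : α} (h : Reach R S n v x) : v ∈ S := by
  cases n <;> exact h.1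

theorem Reach.mono {n m : ℕ} {v x : α} (h : Reach R S n v x)
    (hR : ∀ u ∈ S, ∀ w ∈ S, R u w → R' u w) (hS : S ⊆ S') (hnm : n ≤ m) : Reach R' S' m v x := by
  induction n generalizing m v with
  | zero =>
    cases m with
    | zero => exact ⟨hS h.1, h.2⟩
    | succ m => exact ⟨hS h.1, Or.inl h.2⟩
  | succ n ih =>
    obtain ⟨m, rfl⟩ := Nat.exists_eq_add_of_le' (Nat.one_le_of_lt hnm)
    refine ⟨hS h.1, h.2.imp_right ?_⟩
    rintro ⟨w, hvw, hw⟩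
    exact ⟨w, hR _ h.1 _ hw.start_mem hvw, ih hw (by omega)⟩

/-- Decomposition of a walk at its last exit from `I`. -/
theorem Reach.last_exit {n : ℕ} {v x : α} (h : Reach R S n v x) (I : Set α) :
    Reach R (S \ I) n v x ∨ x ∈ I ∨
      ∃ u ∈ I, ∃ w ∉ I, R u w ∧ ∃ m < n, Reach R (S \ I) m w x := by
  induction n generalizing v with
  | zero =>
    by_cases hx : x ∈ I
    · exact Or.inr (Or.inl hx)
    · exact Or.inl ⟨⟨h.1, h.2 ▸ hx⟩, h.2⟩
  | succ n ih =>
    obtain ⟨hv, rfl | ⟨w, hvw, hw⟩⟩ := h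
    · by_cases hx : v ∈ I
      · exact Or.inr (Or.inl hx)
      · exact Or.inl ⟨⟨hv, hx⟩, Or.inl rfl⟩
    rcases ih hw with h | h | ⟨u, hu, w', hw', hR, m, hm, h⟩
    · by_cases hvI : v ∈ I
      · exact Or.inr (Or.inr ⟨v, hvI, w, h.start_mem.2, hvw, n, n.lt_succ_self, h⟩)
      · exact Or.inl ⟨⟨hv, hvI⟩, Or.inr ⟨w, hvw, h⟩⟩
    · exact Or.inr (Or.inl h)
    · exact Or.inr (Or.inr ⟨u, hu, w', hw', hR, m, hm.trans n.lt_succ_self, h⟩)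

theorem exists_reach_of_reflTransGen {v x : α} (h : Relation.ReflTransGen R v x)
    (hS : ∀ u, Relation.ReflTransGen R v u → u ∈ S) : ∃ n, Reach R S n v x := by
  induction h using Relation.ReflTransGen.head_induction_on with
  | refl => exact ⟨0, hS _ .refl, rfl⟩
  | head hab _ ih =>
    obtain ⟨n, hn⟩ := ih fun u hu => hS u (hu.head hab)
    exact ⟨n + 1, hS _ .refl, Or.inr ⟨_, hab, hn⟩⟩

end Reach

section Skeleton

variable {d : ℕ}

open Classical in
/-- The total weight `∑ ε^{|∂I|}` of the contours `I` surrounding both `v` and `u`. -/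
def contourSum (ε : ℝ≥0∞) (v u : Zd d) : ℝ≥0∞ :=
  ∑' I : Finset (Zd d), if IsContour I ∧ v ∈ I ∧ u ∈ I then ε ^ (edgeBdry I).card else 0

variable {E : Type*} [DecidableEq E]

/-- The edges of `O \ P` as a relation, `T e` being the pairs of points joined by `e`. -/
def OpenStep (T : E → Zd d → Zd d → Prop) (P O : Finset E) (u v : Zd d) : Prop :=
  ∃ e ∈ O, e ∉ P ∧ T e u v

/-- The event that `P` is open, `F` is closed, and `v` is connected to `x` by at most `n` other open
edges in a finite set whose boundary is closed. -/
def skeletonEvent (T : E → Zd d → Zd d → Prop) (D : Set (NNEdge d)) (ι : NNEdge d → E) (x : Zd d)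
    (n : ℕ) (P F : Finset E) (v : Zd d) : Set (Finset E) :=
  {O | P ⊆ O ∧ Disjoint F O ∧ ∃ S : Finset (Zd d), v ∈ S ∧ ↑(edgeBdry S) ⊆ D ∧
    (∀ p ∈ edgeBdry S, ι p ∉ F ∧ ι p ∉ O) ∧ Reach (OpenStep T P O) S n v x}

variable {T : E → Zd d → Zd d → Prop} {D : Set (NNEdge d)} {ι : NNEdge d → E}

theorem exists_of_mem_skeletonEvent {i₀ i₁ : Fin d} (h01 : i₀ ≠ i₁) (hι : Set.InjOn ι D)
    (hT : ∀ e u v a b, T e u v → T e a b → u = a ∨ u = b) {x : Zd d} {n : ℕ} {P F : Finset E}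
    {v : Zd d} {O : Finset E} (hO : O ∈ skeletonEvent T D ι x n P F v) :
    ∃ I : Finset (Zd d), (IsContour I ∧ v ∈ I ∧ ↑(edgeBdry I) ⊆ D ∧ ∀ p ∈ edgeBdry I, ι p ∉ F) ∧
      ∃ u, u ∈ I ∧ ((u = x ∧ P ⊆ O ∧ Disjoint (F ∪ (edgeBdry I).image ι) O) ∨
        (n ≠ 0 ∧ ∃ w e, (T e u w ∧ e ∉ P) ∧
          O ∈ skeletonEvent T D ι x (n - 1) (insert e P) (F ∪ (edgeBdry I).image ι) w)) := by
  obtain ⟨hPO, hFO, S, hvS, hSD, hS, hreach⟩ := hO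
  obtain ⟨I, hvI, hIS, hI⟩ := exists_isContour h01 S hvS
  have hdisj : Disjoint (F ∪ (edgeBdry I).image ι) O := by
    rw [Finset.disjoint_union_left]
    refine ⟨hFO, Finset.disjoint_left.2 fun e he => ?_⟩
    obtain ⟨p, hp, rfl⟩ := Finset.mem_image.1 he
    exact (hS p (hIS hp)).2
  refine ⟨I, ⟨hI, hvI, fun p hp => hSD (hIS hp), fun p hp => (hS p (hIS hp)).1⟩, ?_⟩
  rcases hreach.last_exit (I : Set (Zd d)) with h | h | ⟨u, hu, w, hw, ⟨e, heO, heP, he⟩, m, hm, h⟩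
  · exact absurd hvI h.start_mem.2
  · exact ⟨x, h, Or.inl ⟨rfl, hPO, hdisj⟩⟩
  · refine ⟨u, hu, Or.inr ⟨by omega, w, e, ⟨he, heP⟩, Finset.insert_subset heO hPO, hdisj,
      symmDiff S I, ?_, ?_, ?_, ?_⟩⟩
    · exact Finset.mem_symmDiff.2 (Or.inl h.start_mem)
    · rw [edgeBdry_symmDiff, symmDiff_of_ge hIS]
      exact fun p hp => hSD (Finset.mem_sdiff.1 hp).1
    · intro p hp
      rw [edgeBdry_symmDiff, symmDiff_of_ge hIS] at hp
      obtain ⟨hpS, hpI⟩ := Finset.mem_sdiff.1 hp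
      refine ⟨fun hmem => ?_, (hS p hpS).2⟩
      rcases Finset.mem_union.1 hmem with h | h
      · exact (hS p hpS).1 h
      · obtain ⟨q, hq, hqp⟩ := Finset.mem_image.1 h
        exact hpI (hι (hSD (hIS hq)) (hSD hpS) hqp ▸ hq)
    · refine h.mono ?_ ?_ (by omega)
      · rintro a ha b hb ⟨e', he'O, he'P, he'⟩
        refine ⟨e', he'O, fun hmem => ?_, he'⟩
        rcases Finset.mem_insert.1 hmem with rfl | hmem
        · rcases hT _ _ _ _ _ he he' with rfl | rfl
          · exact ha.2 hu
          · exact hb.2 hu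
        · exact he'P hmem
      · intro y hy
        exact Finset.mem_coe.2 (Finset.mem_symmDiff.2 (Or.inl hy))

open Classical in
theorem measure_setOf_and_le {X : Type*} (m : MeasureTheory.OuterMeasure X) (p : Prop)
    (A : X → Prop) :
    m {O | p ∧ A O} ≤ if p then m {O | A O} else 0 := by
  by_cases h : p <;> simp [h]

theorem measure_setOf_exists_le {X ι : Type*} [Countable ι] (m : MeasureTheory.OuterMeasure X)
    (A : ι → X → Prop) : m {O | ∃ i, A i O} ≤ ∑' i, m {O | A i O} := by
  rw [Set.ofPred_exists]
  exact MeasureTheory.measure_iUnion_le _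

open Classical in
/-- The skeleton expansion: connection probabilities inside closed surfaces are dominated by
supersolutions of the renewal inequality of contours and long edges. -/
theorem measure_skeletonEvent_le [Finite E] {i₀ i₁ : Fin d} (h01 : i₀ ≠ i₁) (hι : Set.InjOn ι D)
    (hT : ∀ e u v a b, T e u v → T e a b → u = a ∨ u = b)
    (m : MeasureTheory.OuterMeasure (Finset E)) {k c : E → ℝ≥0∞}
    (hm : ∀ P F, m {O | P ⊆ O ∧ Disjoint F O} ≤ (∏ e ∈ P, k e) * ∏ e ∈ F, c e)
    {ε : ℝ≥0∞} (hε : ∀ p ∈ D, c (ι p) ≤ ε) {κ : Zd d → Zd d → ℝ≥0∞}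
    (hκ : ∀ u w, ∑' e, (if T e u w then k e else 0) ≤ κ u w) {x : Zd d} {h : Zd d → ℝ≥0∞}
    (hh : ∀ v, ∑' u, contourSum ε v u * ((if u = x then 1 else 0) + ∑' w, κ u w * h w) ≤ h v)
    (n : ℕ) (P F : Finset E) (v : Zd d) :
    m (skeletonEvent T D ι x n P F v) ≤ (∏ e ∈ P, k e) * (∏ e ∈ F, c e) * h v := by
  induction n using Nat.strong_induction_on generalizing P F v with
  | _ n ih =>
  set wt := (∏ e ∈ P, k e) * ∏ e ∈ F, c e with hwt
  set G : Finset (Zd d) → Prop := fun I =>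
    IsContour I ∧ v ∈ I ∧ ↑(edgeBdry I) ⊆ D ∧ ∀ p ∈ edgeBdry I, ι p ∉ F with hG
  have hcost : ∀ I, G I → ∏ e ∈ F ∪ (edgeBdry I).image ι, c e ≤
      (∏ e ∈ F, c e) * ε ^ (edgeBdry I).card := by
    rintro I ⟨_, _, hID, hIF⟩
    rw [Finset.prod_union, Finset.prod_image fun p hp q hq => hι (hID hp) (hID hq)]
    · exact mul_le_mul_right (Finset.prod_le_pow_card _ _ _ fun p hp => hε p (hID hp)) _
    · refine Finset.disjoint_right.2 fun e he => ?_
      obtain ⟨p, hp, rfl⟩ := Finset.mem_image.1 he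
      exact hIF p hp
  have hsub : skeletonEvent T D ι x n P F v ⊆ {O | ∃ I, G I ∧ ∃ u, u ∈ I ∧
      ((u = x ∧ P ⊆ O ∧ Disjoint (F ∪ (edgeBdry I).image ι) O) ∨
        (n ≠ 0 ∧ ∃ w e, (T e u w ∧ e ∉ P) ∧
          O ∈ skeletonEvent T D ι x (n - 1) (insert e P) (F ∪ (edgeBdry I).image ι) w))} :=
    fun O hO => exists_of_mem_skeletonEvent h01 hι hT hO
  have hinner : ∀ I u, G I → m {O |
      (u = x ∧ P ⊆ O ∧ Disjoint (F ∪ (edgeBdry I).image ι) O) ∨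
        (n ≠ 0 ∧ ∃ w e, (T e u w ∧ e ∉ P) ∧
          O ∈ skeletonEvent T D ι x (n - 1) (insert e P) (F ∪ (edgeBdry I).image ι) w)} ≤
      wt * ε ^ (edgeBdry I).card * ((if u = x then 1 else 0) + ∑' w, κ u w * h w) := by
    intro I u hGI
    rw [Set.ofPred_or, mul_add]
    refine (MeasureTheory.measure_union_le _ _).trans (add_le_add ?_ ?_)
    · refine (measure_setOf_and_le m _ _).trans ?_
      split_ifs
      · rw [mul_one, hwt, mul_assoc]
        exact (hm _ _).trans (mul_le_mul_right (hcost I hGI) _)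
      · exact zero_le
    · refine (measure_setOf_and_le m _ _).trans ?_
      split_ifs with hn
      swap
      · exact zero_le
      refine (measure_setOf_exists_le m _).trans ?_
      rw [← ENNReal.tsum_mul_left]
      refine ENNReal.tsum_le_tsum fun w => (measure_setOf_exists_le m _).trans ?_
      calc ∑' e, m {O | (T e u w ∧ e ∉ P) ∧
            O ∈ skeletonEvent T D ι x (n - 1) (insert e P) (F ∪ (edgeBdry I).image ι) w}
          ≤ ∑' e, (if T e u w then k e else 0) * (wt * ε ^ (edgeBdry I).card * h w) := by
            refine ENNReal.tsum_le_tsum fun e => (measure_setOf_and_le m _ _).trans ?_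
            split_ifs with h₁ h₂
            · refine (ih (n - 1) (by omega) _ _ _).trans ?_
              rw [Finset.prod_insert h₁.2]
              calc _ ≤ k e * (∏ e ∈ P, k e) * ((∏ e ∈ F, c e) * ε ^ (edgeBdry I).card) * h w := by
                    gcongr
                    exact hcost I hGI
                _ = _ := by rw [hwt]; ring
            · exact absurd h₁.1 h₂
            · exact zero_le
            · exact zero_le
        _ ≤ κ u w * (wt * ε ^ (edgeBdry I).card * h w) := by
            rw [ENNReal.tsum_mul_right]
            exact mul_le_mul_left (hκ u w) _
        _ = _ := by ring
  calc m (skeletonEvent T D ι x n P F v)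
      ≤ ∑' I, ∑' u, if IsContour I ∧ v ∈ I ∧ u ∈ I then
          wt * ε ^ (edgeBdry I).card * ((if u = x then 1 else 0) + ∑' w, κ u w * h w) else 0 := by
        refine (MeasureTheory.measure_mono hsub).trans ((measure_setOf_exists_le m _).trans ?_)
        refine ENNReal.tsum_le_tsum fun I => (measure_setOf_and_le m _ _).trans ?_
        split_ifs with hGI
        · refine (measure_setOf_exists_le m _).trans (ENNReal.tsum_le_tsum fun u => ?_)
          refine (measure_setOf_and_le m _ _).trans ?_
          by_cases hu : u ∈ I
          · rw [if_pos hu, if_pos ⟨hGI.1, hGI.2.1, hu⟩]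
            exact hinner I u hGI
          · rw [if_neg hu]
            exact zero_le
        · exact zero_le
    _ = ∑' u, ∑' I, if IsContour I ∧ v ∈ I ∧ u ∈ I then
          wt * ε ^ (edgeBdry I).card * ((if u = x then 1 else 0) + ∑' w, κ u w * h w) else 0 :=
        ENNReal.tsum_comm
    _ = wt * ∑' u, contourSum ε v u * ((if u = x then 1 else 0) + ∑' w, κ u w * h w) := by
        rw [← ENNReal.tsum_mul_left]
        refine tsum_congr fun u => ?_
        rw [contourSum, ← ENNReal.tsum_mul_right, ← ENNReal.tsum_mul_left]
        refine tsum_congr fun I => ?_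
        rw [← mul_assoc]
        by_cases hI : IsContour I ∧ v ∈ I ∧ u ∈ I
        · rw [if_pos hI, if_pos hI]
        · rw [if_neg hI, if_neg hI, mul_zero, zero_mul]
    _ ≤ wt * h v := mul_le_mul_right (hh v) _

end Skeleton

section LoopErasure

variable {α : Type*} [DecidableEq α]

/-- The total weight of the `n`-step walks from `a` to `x` for the kernel `K`. -/
def walkSum (K : α → α → ℝ≥0∞) (x : α) : ℕ → α → ℝ≥0∞
  | 0, a => if a = x then 1 else 0
  | n + 1, a => ∑' b, K a b * walkSum K x n b

/-- The Green function of the kernel `K`. -/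
def greenSum (K : α → α → ℝ≥0∞) (x a : α) : ℝ≥0∞ := ∑' n, walkSum K x n a

/-- The total weight of the walks from `a` to `x` avoiding `D` with fewer than `n` steps. -/
def killedSum (K : α → α → ℝ≥0∞) (x : α) : ℕ → Finset α → α → ℝ≥0∞
  | 0, _, _ => 0
  | n + 1, D, a => if a ∈ D then 0 else
      (if a = x then 1 else 0) + ∑' b, K a b * killedSum K x n D b

/-- The total weight of the self-avoiding walks from `a` to `x` avoiding `D` with fewer than `n`
steps. -/
def sawSum (K : α → α → ℝ≥0∞) (x : α) : ℕ → Finset α → α → ℝ≥0∞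
  | 0, _, _ => 0
  | n + 1, D, a => if a ∈ D then 0 else
      (if a = x then 1 else 0) + ∑' b, K a b * sawSum K x n (insert a D) b

open Classical in
/-- The total weight of the injective paths with `k` steps from `a` to `x` avoiding `D`. -/
def pathSum (K : α → α → ℝ≥0∞) (x : α) (k : ℕ) (D : Finset α) (a : α) : ℝ≥0∞ :=
  ∑' γ : Fin (k + 1) → α, if γ 0 = a ∧ γ (Fin.last k) = x ∧ Function.Injective γ ∧ ∀ i, γ i ∉ D
    then ∏ i : Fin k, K (γ i.castSucc) (γ i.succ) else 0

variable {K : α → α → ℝ≥0∞} {x : α}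

theorem killedSum_succ (n : ℕ) (D : Finset α) (a : α) :
    killedSum K x (n + 1) D a = if a ∈ D then 0 else
      (if a = x then 1 else 0) + ∑' b, K a b * killedSum K x n D b := rfl

theorem greenSum_eq (a : α) :
    greenSum K x a = (if a = x then 1 else 0) + ∑' b, K a b * greenSum K x b := by
  rw [greenSum, tsum_eq_zero_add' ENNReal.summable]
  simp_rw [greenSum, ← ENNReal.tsum_mul_left]
  rw [ENNReal.tsum_comm]
  rfl

theorem sum_range_walkSum (n : ℕ) (a : α) :
    ∑ m ∈ Finset.range n, walkSum K x m a = killedSum K x n ∅ a := by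
  induction n generalizing a with
  | zero => rfl
  | succ n ih =>
    rw [Finset.sum_range_succ', killedSum, if_neg (Finset.notMem_empty a), add_comm]
    simp_rw [← ih, Finset.mul_sum, walkSum]
    rw [Summable.tsum_finsetSum fun _ _ => ENNReal.summable]

theorem killedSum_mono (n : ℕ) (D : Finset α) (a : α) :
    killedSum K x n D a ≤ killedSum K x (n + 1) D a := by
  induction n generalizing a with
  | zero => exact zero_le
  | succ n ih =>
    rw [killedSum, killedSum]
    split_ifs
    · exact le_rfl
    all_goals exact add_le_add_right (ENNReal.tsum_le_tsum fun b => mul_le_mul_right (ih b) _) _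

theorem killedSum_le_two (hK : ∀ a, 2 * ∑' b, K a b ≤ 1) (n : ℕ) (D : Finset α) (a : α) :
    killedSum K x n D a ≤ 2 := by
  induction n generalizing a with
  | zero => exact zero_le
  | succ n ih =>
    rw [killedSum]
    split_ifs
    · exact zero_le
    all_goals
      rw [← one_add_one_eq_two]
      refine add_le_add (by simp) ?_
      calc ∑' b, K a b * killedSum K x n D b ≤ ∑' b, K a b * 2 :=
            ENNReal.tsum_le_tsum fun b => mul_le_mul_right (ih b) _
        _ ≤ 1 := by rw [ENNReal.tsum_mul_right, mul_comm]; exact hK a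

theorem killedSum_le_insert_add (hK : ∀ a, 2 * ∑' b, K a b ≤ 1) (n : ℕ) (D : Finset α) (a b : α) :
    killedSum K x n D b ≤ killedSum K x n (insert a D) b + killedSum K x n D a := by
  induction n generalizing b with
  | zero => exact zero_le
  | succ n ih =>
    by_cases hba : b = a
    · rw [hba]; exact le_add_self
    rw [killedSum, killedSum_succ n (insert a D)]
    by_cases hb : b ∈ D
    · simp [hb]
    have hb' : b ∉ insert a D := by simp [hba, hb]
    rw [if_neg hb, if_neg hb', add_assoc]
    refine add_le_add_right ?_ _
    calc ∑' c, K b c * killedSum K x n D c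
        ≤ ∑' c, (K b c * killedSum K x n (insert a D) c + K b c * killedSum K x n D a) :=
          ENNReal.tsum_le_tsum fun c => by rw [← mul_add]; exact mul_le_mul_right (ih c) _
      _ ≤ ∑' c, K b c * killedSum K x n (insert a D) c + 1 * killedSum K x (n + 1) D a := by
          rw [ENNReal.tsum_add, ENNReal.tsum_mul_right]
          refine add_le_add_right (mul_le_mul' ?_ (killedSum_mono n D a)) _
          exact le_trans (by rw [two_mul]; exact le_self_add) (hK b)
      _ = _ := by rw [one_mul]

theorem killedSum_succ_le (hK : ∀ a, 2 * ∑' b, K a b ≤ 1) (n : ℕ) {D : Finset α} {a : α}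
    (ha : a ∉ D) : killedSum K x (n + 1) D a ≤
      2 * ((if a = x then 1 else 0) + ∑' b, K a b * killedSum K x n (insert a D) b) := by
  set X := killedSum K x (n + 1) D a with hX
  set Y := (if a = x then 1 else 0) + ∑' b, K a b * killedSum K x n (insert a D) b with hY
  have hXY : X ≤ Y + (∑' b, K a b) * X := by
    conv_lhs => rw [hX, killedSum, if_neg ha]
    rw [hY, add_assoc]
    refine add_le_add_right ?_ _
    calc ∑' b, K a b * killedSum K x n D b
        ≤ ∑' b, (K a b * killedSum K x n (insert a D) b + K a b * killedSum K x n D a) :=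
          ENNReal.tsum_le_tsum fun b => by
            rw [← mul_add]
            exact mul_le_mul_right (killedSum_le_insert_add hK n D a b) _
      _ ≤ _ := by
          rw [ENNReal.tsum_add, ENNReal.tsum_mul_right]
          exact add_le_add_right (mul_le_mul_right (killedSum_mono n D a) _) _
  have hXtop : X ≠ ∞ := ne_top_of_le_ne_top ENNReal.ofNat_ne_top (killedSum_le_two hK _ _ _)
  have h2 : X + X ≤ 2 * Y + X := by
    calc X + X = 2 * X := (two_mul X).symm
      _ ≤ 2 * (Y + (∑' b, K a b) * X) := mul_le_mul_right hXY _
      _ = 2 * Y + (2 * ∑' b, K a b) * X := by ring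
      _ ≤ 2 * Y + 1 * X := add_le_add_right (mul_le_mul_left (hK a) _) _
      _ = 2 * Y + X := by rw [one_mul]
  exact (ENNReal.add_le_add_iff_right hXtop).1 h2

theorem killedSum_le_sawSum (hK : ∀ a, 2 * ∑' b, K a b ≤ 1) (n : ℕ) (D : Finset α) (a : α) :
    killedSum K x n D a ≤ 2 * sawSum (fun a b => 2 * K a b) x n D a := by
  induction n generalizing D a with
  | zero => exact zero_le
  | succ n ih =>
    by_cases ha : a ∈ D
    · rw [killedSum, if_pos ha]; exact zero_le
    refine (killedSum_succ_le hK n ha).trans ?_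
    rw [sawSum, if_neg ha]
    refine mul_le_mul_right (add_le_add_right (ENNReal.tsum_le_tsum fun b => ?_) _) _
    rw [mul_comm 2 (K a b), mul_assoc]
    exact mul_le_mul_right (ih _ b) _

theorem tsum_mul_pathSum_le (k : ℕ) {D : Finset α} {a : α} (ha : a ∉ D) :
    ∑' b, K a b * pathSum K x k (insert a D) b ≤ pathSum K x (k + 1) D a := by
  classical
  have h₁ : ∑' b, K a b * pathSum K x k (insert a D) b = ∑' γ : Fin (k + 1) → α,
      if γ (Fin.last k) = x ∧ Function.Injective γ ∧ ∀ i, γ i ∉ insert a D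
      then K a (γ 0) * ∏ i : Fin k, K (γ i.castSucc) (γ i.succ) else 0 := by
    simp_rw [pathSum, ← ENNReal.tsum_mul_left]
    rw [ENNReal.tsum_comm]
    refine tsum_congr fun γ => ?_
    rw [tsum_eq_single (γ 0) fun b hb => by rw [if_neg fun h => hb h.1.symm, mul_zero]]
    simp only [true_and, mul_ite, mul_zero]
  rw [h₁, pathSum]
  refine le_trans (ENNReal.tsum_le_tsum fun γ => ?_)
    (ENNReal.tsum_comp_le_tsum_of_injective
      (f := fun γ : Fin (k + 1) → α => (Fin.cons a γ : Fin (k + 2) → α))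
      (Fin.cons_right_injective (α := fun _ => α) a) _)
  split_ifs with h₁ h₂
  · rw [Fin.prod_univ_succ]
    simp
  · refine absurd ⟨rfl, ?_, ?_, ?_⟩ h₂
    · rw [← Fin.succ_last, Fin.cons_succ]; exact h₁.1
    · rw [Fin.cons_injective_iff]
      exact ⟨fun ⟨i, hi⟩ => h₁.2.2 i (hi ▸ Finset.mem_insert_self _ _), h₁.2.1⟩
    · refine Fin.cases ha fun i => ?_
      rw [Fin.cons_succ]
      exact fun h => h₁.2.2 i (Finset.mem_insert_of_mem h)
  · exact zero_le
  · exact zero_le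

theorem sawSum_le_tsum_pathSum (n : ℕ) (D : Finset α) (a : α) :
    sawSum K x n D a ≤ ∑' k, pathSum K x k D a := by
  induction n generalizing D a with
  | zero => exact zero_le
  | succ n ih =>
    rw [sawSum]
    split_ifs with ha hax
    · exact zero_le
    all_goals
      rw [tsum_eq_zero_add' ENNReal.summable]
      refine add_le_add ?_ ?_
    rotate_left
    · calc ∑' b, K a b * sawSum K x n (insert a D) b
          ≤ ∑' b, K a b * ∑' k, pathSum K x k (insert a D) b :=
            ENNReal.tsum_le_tsum fun b => mul_le_mul_right (ih _ b) _
        _ = ∑' k, ∑' b, K a b * pathSum K x k (insert a D) b := by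
            simp_rw [← ENNReal.tsum_mul_left]
            exact ENNReal.tsum_comm
        _ ≤ _ := ENNReal.tsum_le_tsum fun k => tsum_mul_pathSum_le k ha
    · exact zero_le
    · calc ∑' b, K a b * sawSum K x n (insert a D) b
          ≤ ∑' b, K a b * ∑' k, pathSum K x k (insert a D) b :=
            ENNReal.tsum_le_tsum fun b => mul_le_mul_right (ih _ b) _
        _ = ∑' k, ∑' b, K a b * pathSum K x k (insert a D) b := by
            simp_rw [← ENNReal.tsum_mul_left]
            exact ENNReal.tsum_comm
        _ ≤ _ := ENNReal.tsum_le_tsum fun k => tsum_mul_pathSum_le k ha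
    · refine le_trans ?_ (ENNReal.le_tsum fun _ => a)
      rw [if_pos ⟨rfl, hax, fun i j _ => Fin.ext (by omega), fun _ => ha⟩]
      simp

/-- The Green function of a small kernel is dominated by a self-avoiding path sum. -/
theorem greenSum_le_tsum_pathSum (hK : ∀ a, 2 * ∑' b, K a b ≤ 1) (a : α) :
    greenSum K x a ≤ 2 * ∑' k, pathSum (fun a b => 2 * K a b) x k ∅ a := by
  refine ENNReal.summable.tsum_le_of_sum_range_le fun n => ?_
  rw [sum_range_walkSum]
  exact (killedSum_le_sawSum hK n ∅ a).trans (mul_le_mul_right (sawSum_le_tsum_pathSum n ∅ a) _)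

end LoopErasure

section Supersolution

variable {d : ℕ}

theorem l1Norm_eq_zero {x : Zd d} : l1Norm x = 0 ↔ x = 0 := by
  simp [l1Norm, funext_iff]

theorem exists_l1Norm_sub_add_one {x : Zd d} (hx : x ≠ 0) :
    ∃ k, ∃ e, (e = unitVec k ∨ e = -unitVec k) ∧ l1Norm (x - e) + 1 = l1Norm x := by
  obtain ⟨k, hk⟩ := Function.ne_iff.1 hx
  have hk' : x k ≠ 0 := hk
  have key : ∀ s : ℤ, (x k - s).natAbs + 1 = (x k).natAbs →
      l1Norm (x - Pi.single k s) + 1 = l1Norm x := by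
    intro s hs
    rw [l1Norm, l1Norm, ← Finset.add_sum_erase _ _ (Finset.mem_univ k),
      ← Finset.add_sum_erase Finset.univ (fun i => (x i).natAbs) (Finset.mem_univ k), ← hs,
      Finset.sum_congr rfl fun i hi => ?_]
    · simp only [Pi.sub_apply, Pi.single_eq_same]
      ring
    · simp [Finset.ne_of_mem_erase hi]
  rcases lt_or_gt_of_ne hk' with h | h
  · refine ⟨k, _, Or.inr rfl, ?_⟩
    rw [unitVec, ← Pi.single_neg]
    exact key _ (by omega)
  · exact ⟨k, _, Or.inl rfl, key _ (by omega)⟩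

/-- Exponential weights are dominated by any supersolution of the Green equation. -/
theorem tsum_pow_l1Norm_mul_le {μ : ℝ≥0∞} {j φ g : Zd d → ℝ≥0∞}
    (hj : ∀ k, 1 ≤ j (unitVec k) ∧ 1 ≤ j (-unitVec k))
    (hg : ∀ v, φ v + μ * ∑' w, j (w - v) * g w ≤ g v) (v : Zd d) :
    ∑' u, μ ^ l1Norm (u - v) * φ u ≤ g v := by
  have htrunc : ∀ (n : ℕ) (v : Zd d),
      ∑' u, (if l1Norm (u - v) < n then μ ^ l1Norm (u - v) * φ u else 0) ≤ g v := by
    intro n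
    induction n with
    | zero => intro v; simp
    | succ n ih =>
      intro v
      calc ∑' u, (if l1Norm (u - v) < n + 1 then μ ^ l1Norm (u - v) * φ u else 0)
          ≤ ∑' u, ((if u = v then φ u else 0) + μ * ∑' w, j (w - v) *
              (if l1Norm (u - w) < n then μ ^ l1Norm (u - w) * φ u else 0)) := by
            refine ENNReal.tsum_le_tsum fun u => ?_
            split_ifs with h₁ h₂ h₂
            · refine le_add_right ?_
              simp [l1Norm_eq_zero.2 (sub_eq_zero.2 h₂)]
            · obtain ⟨k, e, he, hue⟩ := exists_l1Norm_sub_add_one (sub_ne_zero.2 h₂)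
              refine le_add_left ?_
              rw [← hue, pow_succ', mul_assoc]
              refine mul_le_mul_right (le_trans ?_ (ENNReal.le_tsum (v + e))) _
              rw [← sub_sub, add_sub_cancel_left, if_pos (by omega)]
              refine le_mul_of_one_le_left' ?_
              rcases he with rfl | rfl
              exacts [(hj k).1, (hj k).2]
            all_goals exact zero_le
        _ = φ v + μ * ∑' w, j (w - v) *
              ∑' u, (if l1Norm (u - w) < n then μ ^ l1Norm (u - w) * φ u else 0) := by
            rw [ENNReal.tsum_add, tsum_ite_eq, ENNReal.tsum_mul_left, ENNReal.tsum_comm]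
            simp_rw [ENNReal.tsum_mul_left]
        _ ≤ φ v + μ * ∑' w, j (w - v) * g w :=
            add_le_add_right (mul_le_mul_right
              (ENNReal.tsum_le_tsum fun w => mul_le_mul_right (ih w) _) _) _
        _ ≤ g v := hg v
  refine ENNReal.summable.tsum_le_of_sum_le fun s => ?_
  refine le_trans ?_ (htrunc (s.sup (fun u => l1Norm (u - v)) + 1) v)
  refine le_trans (Finset.sum_le_sum fun u hu => ?_) (ENNReal.sum_le_tsum s)
  rw [if_pos (Nat.lt_succ_of_le (Finset.le_sup (f := fun u => l1Norm (u - v)) hu))]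

/-- The Green function of a renormalised kernel solves the skeleton inequality. -/
theorem tsum_contourSum_mul_le {ε μ δ κ : ℝ≥0∞} {j : Zd d → ℝ≥0∞}
    (hj : ∀ k, 1 ≤ j (unitVec k) ∧ 1 ≤ j (-unitVec k))
    (hε : ∀ v u : Zd d, contourSum ε v u ≤ δ * μ ^ l1Norm (u - v)) (x v : Zd d) :
    ∑' u, contourSum ε v u * ((if u = x then 1 else 0) + ∑' w, κ * j (w - u) *
        (δ * greenSum (fun a b => (μ + κ * δ) * j (b - a)) x w))
      ≤ δ * greenSum (fun a b => (μ + κ * δ) * j (b - a)) x v := by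
  set W := greenSum (fun a b => (μ + κ * δ) * j (b - a)) x with hW
  have hsplit : ∀ u, W u = ((if u = x then 1 else 0) + ∑' w, κ * j (w - u) * (δ * W w)) +
      μ * ∑' w, j (w - u) * W w := by
    intro u
    rw [hW, greenSum_eq, ← hW, add_assoc, ← ENNReal.tsum_mul_left, ← ENNReal.tsum_add]
    congr 1
    exact tsum_congr fun w => by ring
  calc _ ≤ ∑' u, δ * (μ ^ l1Norm (u - v) *
        ((if u = x then 1 else 0) + ∑' w, κ * j (w - u) * (δ * W w))) :=
        ENNReal.tsum_le_tsum fun u => by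
          rw [← mul_assoc]
          exact mul_le_mul_left (hε v u) _
    _ ≤ δ * W v := by
        rw [ENNReal.tsum_mul_left]
        exact mul_le_mul_right (tsum_pow_l1Norm_mul_le hj (fun v => (hsplit v).ge) v) _

/-- Self-avoiding path sums are dominated by the Green function of the killed random walk. -/
theorem tsum_pathSum_le_gkrw {J : Zd d → ℝ} (hJ : ∀ y, 0 ≤ J y) {lam : ℝ} (hlam : 0 ≤ lam)
    {K : Zd d → Zd d → ℝ≥0∞} (hK : ∀ a b, K a b ≤ ENNReal.ofReal (lam * J (b - a)))
    {x : Zd d} (hx : x ≠ 0) : ∑' k, pathSum K x k ∅ 0 ≤ Gkrw d lam J x := by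
  classical
  refine ENNReal.tsum_le_tsum fun n => ENNReal.tsum_le_tsum fun γ => ?_
  split_ifs with h₁ h₂
  · rw [ENNReal.ofReal_prod_of_nonneg fun i _ => mul_nonneg hlam (hJ _)]
    exact Finset.prod_le_prod' fun i _ => hK _ _
  · refine absurd ⟨?_, h₁.1, h₁.2.1, fun i j hij => ?_⟩ h₂
    · by_contra hn
      obtain rfl : n = 0 := by omega
      exact hx (h₁.2.1.symm.trans h₁.1)
    · rcases Sym2.eq_iff.1 hij with ⟨h, _⟩ | ⟨h, h'⟩
      · exact Fin.castSucc_injective n (h₁.2.2.1 h)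
      · have h := congrArg Fin.val (h₁.2.2.1 h)
        have h' := congrArg Fin.val (h₁.2.2.1 h')
        simp at h h'
        omega
  · exact zero_le
  · exact zero_le

end Supersolution

section Coupling

variable {d : ℕ}

theorem summable_prod_pi {f : ℤ → ℝ} (hf : Summable f) (h0 : ∀ n, 0 ≤ f n) (d : ℕ) :
    Summable fun x : Zd d => ∏ i, f (x i) := by
  induction d with
  | zero => exact Summable.of_finite
  | succ d ih =>
    rw [← (Fin.consEquiv fun _ : Fin (d + 1) => ℤ).summable_iff]
    refine (hf.mul_of_nonneg ih h0 fun x => Finset.prod_nonneg fun i _ => h0 _).congr fun p => ?_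
    simp [Fin.prod_univ_succ, Fin.consEquiv]

theorem summable_exp_neg_sum_abs {a : ℝ} (ha : 0 < a) (d : ℕ) :
    Summable fun x : Zd d => Real.exp (-(a * ∑ i, |(x i : ℝ)|)) := by
  have hgeom : Summable fun n : ℕ => Real.exp (-a) ^ n :=
    summable_geometric_of_lt_one (Real.exp_nonneg _) (Real.exp_lt_one_iff.2 (by linarith))
  have h₁ : Summable fun n : ℤ => Real.exp (-(a * |(n : ℝ)|)) := by
    refine Summable.of_nat_of_neg ?_ ?_
    all_goals
      refine hgeom.congr fun n => ?_
      rw [← Real.exp_nat_mul]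
      simp [mul_comm]
  refine (summable_prod_pi h₁ (fun _ => Real.exp_nonneg _) d).congr fun x => ?_
  rw [← Real.exp_sum, Finset.mul_sum, Finset.sum_neg_distrib]

theorem eNorm_le_sum_abs (x : Zd d) : eNorm x ≤ ∑ i, |(x i : ℝ)| := by
  rw [eNorm, Real.sqrt_le_left (Finset.sum_nonneg fun i _ => abs_nonneg _)]
  refine (Finset.sum_congr rfl fun i _ => (sq_abs (x i : ℝ)).symm).trans_le ?_
  exact Finset.sum_sq_le_sq_sum_of_nonneg fun i _ => abs_nonneg _

theorem abs_apply_le_eNorm (x : Zd d) (i : Fin d) : |(x i : ℝ)| ≤ eNorm x := by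
  rw [eNorm, ← Real.sqrt_sq_eq_abs]
  exact Real.sqrt_le_sqrt (Finset.single_le_sum (f := fun i => (x i : ℝ) ^ 2)
    (fun i _ => sq_nonneg _) (Finset.mem_univ i))

theorem finite_eNorm_lt (d : ℕ) (R : ℝ) : {x : Zd d | eNorm x < R}.Finite := by
  refine (box d ⌈R⌉₊).finite_toSet.subset fun x hx => ?_
  rw [Finset.mem_coe, box, Fintype.mem_piFinset]
  intro i
  have h : |(x i : ℝ)| ≤ (⌈R⌉₊ : ℕ) := (abs_apply_le_eNorm x i).trans (hx.le.trans (Nat.le_ceil R))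
  rw [Finset.mem_Icc, ← abs_le]
  exact_mod_cast h

theorem eNorm_unitVec (k : Fin d) : eNorm (unitVec k) = 1 := by
  simp [eNorm, unitVec, Pi.single_apply]

/-- A sign-symmetric norm dominates a multiple of the `ℓ¹` norm. -/
theorem exists_mul_sum_abs_le {ρ : (Fin d → ℝ) → ℝ} (htri : ∀ x y, ρ (x + y) ≤ ρ x + ρ y)
    (hhom : ∀ (c : ℝ) (x), ρ (c • x) = |c| * ρ x) (hdef : ∀ x, ρ x = 0 → x = 0)
    (hsign : ∀ ε : Fin d → ℝ, (∀ i, ε i = 1 ∨ ε i = -1) →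
      ∀ x : Fin d → ℝ, ρ (fun i => ε i * x i) = ρ x) (hd : 0 < d) :
    ∃ c, 0 < c ∧ ∀ x, c * ∑ i, |x i| ≤ ρ x := by
  have hneg : ∀ x, ρ (-x) = ρ x := fun x => by simpa using hhom (-1) x
  have hnonneg : ∀ x, 0 ≤ ρ x := fun x => by
    have h₁ := htri x (-x)
    have h₂ := hhom 0 0
    rw [add_neg_cancel, hneg] at h₁
    simp only [smul_zero, abs_zero, zero_mul] at h₂
    linarith
  have hpos : ∀ i, 0 < ρ (Pi.single i 1) := fun i => (hnonneg _).lt_of_ne fun h => by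
    simpa using congrFun (hdef _ h.symm) i
  have hcoord : ∀ x i, |x i| * ρ (Pi.single i 1) ≤ ρ x := by
    intro x i
    have h₁ := htri x (-fun j => (if j = i then -1 else 1) * x j)
    rw [hneg, hsign _ (fun j => by by_cases h : j = i <;> simp [h])] at h₁
    have h₂ : x + -(fun j => (if j = i then -1 else 1) * x j) =
        (2 * x i) • Pi.single i (1 : ℝ) := by
      ext j
      by_cases h : j = i
      · subst h; simp; ring
      · simp [h]
    rw [h₂, hhom, abs_mul, abs_two] at h₁
    linarith
  have : Nonempty (Fin d) := ⟨⟨0, hd⟩⟩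
  obtain ⟨k, hk⟩ := Finite.exists_min fun i => ρ (Pi.single i (1 : ℝ))
  have hd' : (0 : ℝ) < d := Nat.cast_pos.2 hd
  refine ⟨ρ (Pi.single k 1) / d, div_pos (hpos k) hd', fun x => ?_⟩
  rw [div_mul_eq_mul_div, div_le_iff₀ hd', Finset.mul_sum]
  calc ∑ i, ρ (Pi.single k 1) * |x i| ≤ ∑ _i : Fin d, ρ x := Finset.sum_le_sum fun i _ => by
        rw [mul_comm]
        exact (mul_le_mul_of_nonneg_left (hk i) (abs_nonneg _)).trans (hcoord x i)
    _ = ρ x * d := by simp [mul_comm]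

/-- Couplings decaying like a subexponential prefactor times `e^{-ρ}` are summable. -/
theorem summable_coupling {ρ : (Fin d → ℝ) → ℝ} {c : ℝ} (hc : 0 < c)
    (hρ : ∀ x, c * ∑ i, |x i| ≤ ρ x) {ψ J : Zd d → ℝ} (hψ : ∀ x, x ≠ 0 → 0 < ψ x)
    (hsub : ∀ ε : ℝ, 0 < ε → ∃ R : ℝ, ∀ x : Zd d,
      R ≤ eNorm x → |Real.log (ψ x)| ≤ ε * eNorm x)
    (hJ : ∀ x : Zd d, x ≠ 0 → J x = ψ x * Real.exp (-ρ (toR x))) : Summable J := by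
  obtain ⟨R, hR⟩ := hsub (c / 2) (half_pos hc)
  refine Summable.of_norm_bounded_eventually
    (summable_exp_neg_sum_abs (half_pos hc) d) ?_
  refine ((finite_eNorm_lt d R).union (Set.finite_singleton 0)).subset fun x hx => ?_
  by_contra hmem
  rw [Set.mem_union, not_or, Set.mem_singleton_iff] at hmem
  have hxR : R ≤ eNorm x := not_lt.1 hmem.1
  refine hx (?_ : ‖J x‖ ≤ Real.exp (-(c / 2 * ∑ i, |(x i : ℝ)|)))
  have h₁ : ψ x ≤ Real.exp (c / 2 * ∑ i, |(x i : ℝ)|) := by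
    rw [← Real.exp_log (hψ x hmem.2), Real.exp_le_exp]
    exact (le_abs_self _).trans ((hR x hxR).trans
      (mul_le_mul_of_nonneg_left (eNorm_le_sum_abs x) (half_pos hc).le))
  have h₂ := hρ (toR x)
  rw [hJ x hmem.2, Real.norm_of_nonneg (mul_nonneg (hψ x hmem.2).le (Real.exp_nonneg _))]
  calc ψ x * Real.exp (-ρ (toR x))
      ≤ Real.exp (c / 2 * ∑ i, |(x i : ℝ)|) * Real.exp (-(c * ∑ i, |(x i : ℝ)|)) :=
        mul_le_mul h₁ (Real.exp_le_exp.2 (neg_le_neg h₂)) (Real.exp_nonneg _) (Real.exp_nonneg _)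
    _ = Real.exp (-(c / 2 * ∑ i, |(x i : ℝ)|)) := by
        rw [← Real.exp_add]
        congr 1
        ring

end Coupling

section IsingGraph

variable {d : ℕ} {Λ : Finset (Zd d)}

/-- The bonds of the Ising model in `Λ`: ordered pairs of vertices, and `2 * d` parallel bonds from
each vertex to the ghost vertex. -/
abbrev IsingEdge (Λ : Finset (Zd d)) :=
  ({x // x ∈ Λ} × {x // x ∈ Λ}) ⊕ ({x // x ∈ Λ} × (Fin d × Bool))

/-- The first endpoint of a bond. -/
def edgeFst : IsingEdge Λ → Option {x // x ∈ Λ} :=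
  Sum.elim (fun p => some p.1) fun p => some p.1

/-- The second endpoint of a bond, `none` being the ghost vertex. -/
def edgeSnd : IsingEdge Λ → Option {x // x ∈ Λ} :=
  Sum.elim (fun p => some p.2) fun _ => none

/-- The magnetic field induced at `i` by plus spins outside `Λ`. -/
def outerField (J : Zd d → ℝ) (Λ : Finset (Zd d)) (i : Zd d) : ℝ :=
  ∑' j : {y : Zd d // y ∉ Λ}, J (i - (j : Zd d))

/-- The coupling constant of a bond. -/
def edgeCoupling (β : ℝ) (J : Zd d → ℝ) : IsingEdge Λ → ℝ :=
  Sum.elim (fun p => β * J ((p.1 : Zd d) - (p.2 : Zd d)) / 2)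
    fun p => β * outerField J Λ p.1 / (2 * d)

/-- The pairs of points joined by a bond. -/
def Joins (e : IsingEdge Λ) (u v : Zd d) : Prop :=
  Sum.elim (fun p => (u = p.1 ∧ v = p.2) ∨ (u = p.2 ∧ v = p.1)) (fun _ => False) e

/-- The nearest-neighbour edges touching `Λ`. -/
def touching (Λ : Finset (Zd d)) : Set (NNEdge d) := {p | p.1 ∈ Λ ∨ p.1 + unitVec p.2 ∈ Λ}

/-- The bond carried by a nearest-neighbour edge touching `Λ`, edges leaving `Λ` being represented
by bonds to the ghost vertex. -/
def edgeLabel (o : {x // x ∈ Λ}) (p : NNEdge d) : IsingEdge Λ :=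
  if h : p.1 ∈ Λ then
    if h' : p.1 + unitVec p.2 ∈ Λ then Sum.inl (⟨_, h⟩, ⟨_, h'⟩) else Sum.inr (⟨_, h⟩, (p.2, true))
  else if h' : p.1 + unitVec p.2 ∈ Λ then Sum.inr (⟨_, h'⟩, (p.2, false))
  else Sum.inr (o, (p.2, false))

theorem unitVec_injective : Function.Injective (unitVec : Fin d → Zd d) := fun k l h => by
  by_contra hkl
  simpa [unitVec, hkl] using congrFun h k

theorem edgeLabel_injOn (o : {x // x ∈ Λ}) : Set.InjOn (edgeLabel o) (touching Λ) := by
  rintro ⟨y, k⟩ hp ⟨z, l⟩ hq h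
  simp only [touching, Set.mem_ofPred_eq] at hp hq
  unfold edgeLabel at h
  split_ifs at h
  all_goals simp_all [Prod.ext_iff]
  · obtain ⟨rfl, h⟩ := h
    exact unitVec_injective (add_left_cancel h)
  · obtain ⟨h, rfl⟩ := h
    exact add_right_cancel h

theorem Joins.eq_or_eq (e : IsingEdge Λ) (u v a b : Zd d) (h : Joins e u v) (h' : Joins e a b) :
    u = a ∨ u = b := by
  rcases e with p | p
  · rcases h with ⟨rfl, rfl⟩ | ⟨rfl, rfl⟩ <;> rcases h' with ⟨rfl, rfl⟩ | ⟨rfl, rfl⟩ <;> simp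
  · exact h.elim

theorem outerField_nonneg {J : Zd d → ℝ} (hJ : ∀ x, 0 ≤ J x) (Λ : Finset (Zd d)) (i : Zd d) :
    0 ≤ outerField J Λ i := tsum_nonneg fun _ => hJ _

theorem edgeCoupling_nonneg {β : ℝ} (hβ : 0 ≤ β) {J : Zd d → ℝ} (hJ : ∀ x, 0 ≤ J x)
    (e : IsingEdge Λ) : 0 ≤ edgeCoupling β J e := by
  rcases e with p | p
  · exact div_nonneg (mul_nonneg hβ (hJ _)) zero_le_two
  · exact div_nonneg (mul_nonneg hβ (outerField_nonneg hJ _ _)) (by positivity)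

theorem le_outerField {J : Zd d → ℝ} (hJ : ∀ x, 0 ≤ J x) (hsum : Summable J) {i j : Zd d}
    (hj : j ∉ Λ) : J (i - j) ≤ outerField J Λ i := by
  have hinj : Function.Injective fun j : {y : Zd d // y ∉ Λ} => i - (j : Zd d) := fun a b h =>
    Subtype.ext (sub_right_injective h)
  exact (hsum.comp_injective hinj).le_tsum (⟨j, hj⟩ : {y : Zd d // y ∉ Λ}) fun _ _ => hJ _

theorem le_edgeCoupling_edgeLabel (hd : 0 < d) {β : ℝ} (hβ : 0 ≤ β) {J : Zd d → ℝ}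
    (hJ : ∀ x, 0 ≤ J x) (hsum : Summable J)
    (hJ1 : ∀ k, J (unitVec k) = 1 ∧ J (-unitVec k) = 1) (o : {x // x ∈ Λ}) {p : NNEdge d}
    (hp : p ∈ touching Λ) : β / (2 * d) ≤ edgeCoupling β J (edgeLabel o p) := by
  have hd' : (1 : ℝ) ≤ d := by exact_mod_cast hd
  have hghost : ∀ {i j : Zd d}, j ∉ Λ → J (i - j) = 1 →
      β / (2 * d) ≤ β * outerField J Λ i / (2 * d) := fun hj h1 => by
    refine div_le_div_of_nonneg_right (le_mul_of_one_le_right hβ ?_) (by positivity)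
    rw [← h1]
    exact le_outerField hJ hsum hj
  unfold edgeLabel
  split_ifs with h h' h'
  · simp only [edgeCoupling, Sum.elim_inl, sub_add_cancel_left, hJ1, mul_one]
    exact div_le_div_of_nonneg_left hβ two_pos (by linarith)
  · exact hghost h' (by simp [hJ1])
  · exact hghost h (by simp [hJ1])
  · exact absurd hp (by simp [touching, h, h'])

theorem beta_mul_plusEnergy_eq (hd : 0 < d) (N : ℕ) (β : ℝ) (J : Zd d → ℝ)
    (σ : {x // x ∈ box d N} → Bool) : β * plusEnergy d N J σ =
      ∑ e : IsingEdge (box d N), edgeCoupling β J e * bond edgeFst edgeSnd e σ := by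
  have hd' : (d : ℝ) ≠ 0 := by exact_mod_cast hd.ne'
  rw [plusEnergy, Fintype.sum_sum_type, Fintype.sum_prod_type, Fintype.sum_prod_type, mul_add]
  congr 1
  · simp only [Finset.mul_sum, edgeCoupling, bond, edgeFst, edgeSnd, ghostSpin, Sum.elim_inl]
    refine Finset.sum_congr rfl fun i _ => Finset.sum_congr rfl fun j _ => ?_
    ring
  · simp only [edgeCoupling, bond, edgeFst, edgeSnd, ghostSpin, Sum.elim_inr, Finset.sum_const,
      Finset.card_univ, Fintype.card_prod, Fintype.card_fin, Fintype.card_bool, Finset.mul_sum,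
      nsmul_eq_mul]
    refine Finset.sum_congr rfl fun i _ => ?_
    rw [← outerField]
    push_cast
    field_simp

theorem plusWeight_eq (hd : 0 < d) (N : ℕ) (β : ℝ) (J : Zd d → ℝ)
    (σ : {x // x ∈ box d N} → Bool) : plusWeight d N β J σ =
      ∏ e : IsingEdge (box d N), Real.exp (edgeCoupling β J e * bond edgeFst edgeSnd e σ) := by
  rw [plusWeight, beta_mul_plusEnergy_eq hd, Real.exp_sum]

theorem tsum_ite_le_of_unique {ι : Type*} {p : ι → Prop} [DecidablePred p]
    (hp : ∀ i j, p i → p j → i = j) {f : ι → ℝ≥0∞} {A : ℝ≥0∞}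
    (hf : ∀ i, p i → f i ≤ A) : ∑' i, (if p i then f i else 0) ≤ A := by
  by_cases h : ∃ i, p i
  · obtain ⟨i, hi⟩ := h
    rw [tsum_eq_single i fun j hj => if_neg fun hpj => hj (hp _ _ hpj hi), if_pos hi]
    exact hf i hi
  · push Not at h
    simp [h]

open Classical in
theorem tsum_joins_le {β : ℝ} (hβ : 0 ≤ β) {J : Zd d → ℝ} (hJe : ∀ x, J (-x) = J x) (u w : Zd d) :
    ∑' e : IsingEdge Λ, (if Joins e u w then ENNReal.ofReal (2 * edgeCoupling β J e) else 0) ≤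
      ENNReal.ofReal (2 * β) * ENNReal.ofReal (J (w - u)) := by
  have hJe' : ∀ a b, J (a - b) = J (b - a) := fun a b => by rw [← hJe, neg_sub]
  rw [← ENNReal.ofReal_mul (by positivity), ENNReal.summable.tsum_sum ENNReal.summable]
  have h₂ : ∀ p : {x // x ∈ Λ} × (Fin d × Bool), ¬ Joins (Sum.inr p : IsingEdge Λ) u w :=
    fun _ h => h
  simp only [h₂, if_false, tsum_zero, add_zero]
  calc ∑' p : {x // x ∈ Λ} × {x // x ∈ Λ}, (if Joins (Sum.inl p : IsingEdge Λ) u w then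
          ENNReal.ofReal (2 * edgeCoupling β J (Sum.inl p : IsingEdge Λ)) else 0)
      ≤ ∑' p : {x // x ∈ Λ} × {x // x ∈ Λ}, ((if u = p.1 ∧ w = p.2 then
          ENNReal.ofReal (2 * edgeCoupling β J (Sum.inl p : IsingEdge Λ)) else 0) +
          (if u = p.2 ∧ w = p.1 then
          ENNReal.ofReal (2 * edgeCoupling β J (Sum.inl p : IsingEdge Λ)) else 0)) := by
        refine ENNReal.tsum_le_tsum fun p => ?_
        by_cases h : Joins (Sum.inl p : IsingEdge Λ) u w
        · rw [if_pos h]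
          rcases h with h | h
          · rw [if_pos h]; exact le_self_add
          · rw [if_pos h]; exact le_add_self
        · rw [if_neg h]; exact zero_le
    _ ≤ ENNReal.ofReal (β * J (w - u)) + ENNReal.ofReal (β * J (w - u)) := by
        rw [ENNReal.tsum_add]
        refine add_le_add (tsum_ite_le_of_unique ?_ ?_) (tsum_ite_le_of_unique ?_ ?_)
        · rintro ⟨i, j⟩ ⟨i', j'⟩ ⟨h₁, h₂⟩ ⟨h₃, h₄⟩
          exact Prod.ext (Subtype.ext (h₁.symm.trans h₃)) (Subtype.ext (h₂.symm.trans h₄))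
        · rintro ⟨i, j⟩ ⟨rfl, rfl⟩
          rw [hJe' (j : Zd d) i]
          refine (congrArg ENNReal.ofReal ?_).le
          simp only [edgeCoupling, Sum.elim_inl]
          ring
        · rintro ⟨i, j⟩ ⟨i', j'⟩ ⟨h₁, h₂⟩ ⟨h₃, h₄⟩
          exact Prod.ext (Subtype.ext (h₂.symm.trans h₄)) (Subtype.ext (h₁.symm.trans h₃))
        · rintro ⟨i, j⟩ ⟨rfl, rfl⟩
          refine (congrArg ENNReal.ofReal ?_).le
          simp only [edgeCoupling, Sum.elim_inl]
          ring
    _ = ENNReal.ofReal (2 * β * J (w - u)) := by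
        rw [← two_mul, mul_assoc, ENNReal.ofReal_mul two_pos.le, ENNReal.ofReal_ofNat]

open Classical in
/-- A connection avoiding the ghost vertex takes place inside a closed surface. -/
theorem exists_mem_skeletonEvent {o x : {x // x ∈ Λ}} {O : Finset (IsingEdge Λ)}
    (hx : Relation.ReflTransGen (Linked edgeFst edgeSnd O) (some o) (some x))
    (hg : ¬ Relation.ReflTransGen (Linked edgeFst edgeSnd O) (some o) none) :
    ∃ n, O ∈ skeletonEvent Joins (touching Λ) (edgeLabel o) (x : Zd d) n ∅ ∅ (o : Zd d) := by
  set C := Relation.ReflTransGen (Linked edgeFst edgeSnd O) (some o) with hC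
  set S : Finset (Zd d) := (Finset.univ.filter fun i : {x // x ∈ Λ} => C (some i)).image
    Subtype.val with hSdef
  have hS : ∀ {i : Zd d} (hi : i ∈ Λ), i ∈ S ↔ C (some ⟨i, hi⟩) := fun {i} hi => by
    simp [hSdef, hi]
  have hSΛ : ∀ {i : Zd d}, i ∈ S → i ∈ Λ := fun {i} hi => by
    simp only [hSdef, Finset.mem_image] at hi
    obtain ⟨j, -, rfl⟩ := hi
    exact j.2
  have hto : ∀ z, C z → ∃ i : {x // x ∈ Λ}, z = some i ∧
      Relation.ReflTransGen (OpenStep Joins ∅ O) (o : Zd d) i := by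
    intro z hz
    induction hz with
    | refl => exact ⟨o, rfl, .refl⟩
    | tail hz hstep ih =>
      rename_i y z
      obtain ⟨i, rfl, hi⟩ := ih
      cases z with
      | none => exact absurd (Relation.ReflTransGen.tail hz hstep) hg
      | some j =>
        refine ⟨j, rfl, hi.tail ?_⟩
        obtain ⟨e, he, h⟩ := hstep
        refine ⟨e, he, Finset.notMem_empty _, ?_⟩
        rcases e with p | p
        · simp only [edgeFst, edgeSnd, Sum.elim_inl, Option.some_inj] at h
          simp only [Joins, Sum.elim_inl]
          rcases h with ⟨rfl, rfl⟩ | ⟨rfl, rfl⟩ <;> simp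
        · simp [edgeFst, edgeSnd] at h
  have hfrom : ∀ u, Relation.ReflTransGen (OpenStep Joins ∅ O) (o : Zd d) u → u ∈ S := by
    intro u hu
    induction hu with
    | refl => exact (hS o.2).2 .refl
    | tail _ hstep ih =>
      obtain ⟨e, he, -, h⟩ := hstep
      rcases e with p | p
      · rcases h with ⟨rfl, rfl⟩ | ⟨rfl, rfl⟩
        · exact (hS p.2.2).2 (((hS p.1.2).1 ih).tail ⟨_, he, Or.inl ⟨rfl, rfl⟩⟩)
        · exact (hS p.1.2).2 (((hS p.2.2).1 ih).tail ⟨_, he, Or.inr ⟨rfl, rfl⟩⟩)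
      · exact h.elim
  obtain ⟨i, hxi, hi⟩ := hto _ hx
  obtain rfl := Option.some_inj.1 hxi
  obtain ⟨n, hn⟩ := exists_reach_of_reflTransGen (S := (S : Set (Zd d))) hi hfrom
  refine ⟨n, Finset.empty_subset _, Finset.disjoint_empty_left _, S, hfrom _ .refl, ?_, ?_, hn⟩
  · intro p hp
    have := mem_edgeBdry.1 (Finset.mem_coe.1 hp)
    by_cases h : p.1 ∈ S
    · exact Or.inl (hSΛ h)
    · exact Or.inr (hSΛ (by tauto))
  · intro p hp
    refine ⟨Finset.notMem_empty _, fun hO => mem_edgeBdry.1 hp ?_⟩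
    unfold edgeLabel at hO
    split_ifs at hO with h h' h'
    · rw [hS h, hS h']
      exact ⟨fun hr => hr.tail ⟨_, hO, Or.inl ⟨rfl, rfl⟩⟩,
        fun hr => hr.tail ⟨_, hO, Or.inr ⟨rfl, rfl⟩⟩⟩
    · refine iff_of_false (fun hm => hg ?_) fun hm => h' (hSΛ hm)
      exact ((hS h).1 hm).tail ⟨_, hO, Or.inl ⟨rfl, rfl⟩⟩
    · refine iff_of_false (fun hm => h (hSΛ hm)) fun hm => hg ?_
      exact ((hS h').1 hm).tail ⟨_, hO, Or.inl ⟨rfl, rfl⟩⟩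
    · exact iff_of_false (fun hm => h (hSΛ hm)) fun hm => h' (hSΛ hm)

theorem skeletonEvent_mono {E : Type*} [DecidableEq E] {T : E → Zd d → Zd d → Prop}
    {D : Set (NNEdge d)} {ι : NNEdge d → E} {x : Zd d} {n m : ℕ} (hnm : n ≤ m) {P F : Finset E}
    {v : Zd d} : skeletonEvent T D ι x n P F v ⊆ skeletonEvent T D ι x m P F v := by
  rintro O ⟨hP, hF, S, hv, hSD, hS, h⟩
  exact ⟨hP, hF, S, hv, hSD, hS, h.mono (fun _ _ _ _ h => h) subset_rfl hnm⟩

end IsingGraph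

section Covariance

variable {d : ℕ}

open Classical in
/-- The truncated two-point function is bounded by any solution of the skeleton inequality. -/
theorem ofReal_plusCov_le {i₀ i₁ : Fin d} (h01 : i₀ ≠ i₁) {N : ℕ} {β : ℝ} (hβ : 0 ≤ β)
    {J : Zd d → ℝ} (hJ : ∀ x, 0 ≤ J x) (hJe : ∀ x, J (-x) = J x) (hsum : Summable J)
    (hJ1 : ∀ k, J (unitVec k) = 1 ∧ J (-unitVec k) = 1) {ε : ℝ≥0∞}
    (hε : ENNReal.ofReal ((Real.cosh (β / (2 * d)))⁻¹ ^ 2) ≤ ε) {x : Zd d} {h : Zd d → ℝ≥0∞}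
    (hh : ∀ v, ∑' u, contourSum ε v u * ((if u = x then 1 else 0) +
      ∑' w, ENNReal.ofReal (2 * β) * ENNReal.ofReal (J (w - u)) * h w) ≤ h v)
    (h0 : (0 : Zd d) ∈ box d N) (hx : x ∈ box d N) :
    ENNReal.ofReal (plusCov d N β J 0 x h0 hx) ≤ h 0 := by
  have hd : 0 < d := i₀.pos
  set o : {x // x ∈ box d N} := ⟨0, h0⟩ with ho
  obtain ⟨c, hc0, hcov, hc⟩ := covariance_le (a := edgeFst (Λ := box d N)) (b := edgeSnd)
    (edgeCoupling_nonneg hβ hJ) o ⟨x, hx⟩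
  set Conn : Finset (IsingEdge (box d N)) → Prop := fun O =>
    Relation.ReflTransGen (Linked edgeFst edgeSnd O) (some o) (some ⟨x, hx⟩) ∧
      ¬ Relation.ReflTransGen (Linked edgeFst edgeSnd O) (some o) none with hConn
  set m : MeasureTheory.OuterMeasure (Finset (IsingEdge (box d N))) :=
    MeasureTheory.OuterMeasure.sum fun O =>
      ENNReal.ofReal (c O) • MeasureTheory.OuterMeasure.dirac O with hm
  have hmeas : ∀ p : Finset (IsingEdge (box d N)) → Prop,
      m {O | p O} = ENNReal.ofReal (∑ O, if p O then c O else 0) := by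
    intro p
    rw [hm, MeasureTheory.OuterMeasure.sum_apply, tsum_fintype,
      ENNReal.ofReal_sum_of_nonneg fun O _ => by split_ifs <;> simp [hc0]]
    refine Finset.sum_congr rfl fun O _ => ?_
    by_cases hp : p O <;> simp [hp]
  have hcyl : ∀ P F : Finset (IsingEdge (box d N)), m {O | P ⊆ O ∧ Disjoint F O} ≤
      (∏ e ∈ P, ENNReal.ofReal (2 * edgeCoupling β J e)) *
        ∏ e ∈ F, ENNReal.ofReal ((Real.cosh (edgeCoupling β J e))⁻¹ ^ 2) := by
    intro P F
    rw [hmeas, ← Finset.sum_filter,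
      ← ENNReal.ofReal_prod_of_nonneg fun e _ =>
        mul_nonneg two_pos.le (edgeCoupling_nonneg hβ hJ e),
      ← ENNReal.ofReal_prod_of_nonneg fun e _ => sq_nonneg _,
      ← ENNReal.ofReal_mul (Finset.prod_nonneg fun e _ =>
        mul_nonneg two_pos.le (edgeCoupling_nonneg hβ hJ e))]
    refine ENNReal.ofReal_le_ofReal ?_
    convert hc P F
  have hclosed : ∀ p ∈ touching (box d N),
      ENNReal.ofReal ((Real.cosh (edgeCoupling β J (edgeLabel o p)))⁻¹ ^ 2) ≤ ε := by
    intro p hp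
    refine le_trans (ENNReal.ofReal_le_ofReal ?_) hε
    refine pow_le_pow_left₀ (inv_nonneg.2 (Real.cosh_pos _).le) ?_ 2
    refine inv_anti₀ (Real.cosh_pos _) ?_
    have hle := le_edgeCoupling_edgeLabel hd hβ hJ hsum hJ1 o hp
    rw [Real.cosh_le_cosh, abs_of_nonneg (by positivity)]
    exact hle.trans (le_abs_self _)
  have hn : ∀ O, ∃ n, Conn O →
      O ∈ skeletonEvent Joins (touching (box d N)) (edgeLabel o) x n ∅ ∅ 0 :=
    fun O => by
      by_cases hO : Conn O
      · obtain ⟨n, hn⟩ := exists_mem_skeletonEvent hO.1 hO.2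
        exact ⟨n, fun _ => hn⟩
      · exact ⟨0, fun h => absurd h hO⟩
  choose n hn using hn
  calc ENNReal.ofReal (plusCov d N β J 0 x h0 hx) ≤ m {O | Conn O} := by
        rw [hmeas]
        refine ENNReal.ofReal_le_ofReal ?_
        refine (hcov (plusWeight d N β J) (plusWeight_eq hd N β J)).trans_eq ?_
        exact Finset.sum_congr rfl fun O _ => by congr
    _ ≤ m (skeletonEvent Joins (touching (box d N)) (edgeLabel o) x (Finset.univ.sup n) ∅ ∅ 0) :=
        m.mono fun O hO => skeletonEvent_mono (Finset.le_sup (Finset.mem_univ O)) (hn O hO)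
    _ ≤ h 0 := by
        simpa using measure_skeletonEvent_le h01 (edgeLabel_injOn o) Joins.eq_or_eq m hcyl hclosed
          (tsum_joins_le hβ hJe) hh (Finset.univ.sup n) ∅ ∅ 0

end Covariance

section Parameters

open Filter in
/-- Low temperature makes all the parameters of the expansion small. -/
theorem exists_threshold {d : ℕ} (hd : 2 ≤ d) {lam : ℝ} (hlam : 0 < lam) (M A : ℝ) :
    ∃ β₀ : ℝ, ∀ β, β₀ ≤ β → 1 ≤ β ∧ 2 * (β⁻¹ ^ d) ≤ 1 ∧ 2 * (β⁻¹ ^ d * M) ≤ 1 ∧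
      (Real.cosh (β / (2 * d)))⁻¹ ^ 2 ≤ β⁻¹ ^ (6 * d) ∧
      2 * (β⁻¹ + 2 * β * β⁻¹ ^ d) ≤ lam ∧ 2 * ((β⁻¹ + 2 * β * β⁻¹ ^ d) * A) ≤ 1 := by
  have hd0 : (0 : ℝ) < d := by positivity
  have hinv : Tendsto (fun β : ℝ => β⁻¹) atTop (nhds 0) := tendsto_inv_atTop_zero
  have hpow : Tendsto (fun β : ℝ => β⁻¹ ^ d) atTop (nhds 0) := by
    simpa only [zero_pow (by omega : d ≠ 0)] using hinv.pow d
  have hkap : Tendsto (fun β : ℝ => β⁻¹ + 2 * β * β⁻¹ ^ d) atTop (nhds 0) := by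
    have h₁ : Tendsto (fun β : ℝ => 2 * β⁻¹ ^ (d - 1)) atTop (nhds 0) := by
      simpa only [zero_pow (by omega : d - 1 ≠ 0), mul_zero] using (hinv.pow (d - 1)).const_mul 2
    refine (by simpa using hinv.add h₁ : Tendsto (fun β : ℝ => β⁻¹ + 2 * β⁻¹ ^ (d - 1)) atTop
      (nhds 0)).congr' ?_
    filter_upwards [eventually_gt_atTop 0] with β hβ
    obtain ⟨n, rfl⟩ : ∃ n, d = n + 1 := ⟨d - 1, by omega⟩
    rw [Nat.add_sub_cancel, pow_succ]
    field_simp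
  have hexp : ∀ᶠ β : ℝ in atTop, (Real.cosh (β / (2 * d)))⁻¹ ^ 2 ≤ β⁻¹ ^ (6 * d) := by
    have h₁ := isLittleO_pow_exp_pos_mul_atTop (k := 6 * d) (inv_pos.2 hd0)
    filter_upwards [h₁.bound (show (0 : ℝ) < 1 / 4 by norm_num), eventually_gt_atTop 0] with β hb hβ
    rw [Real.norm_of_nonneg (by positivity), Real.norm_of_nonneg (Real.exp_nonneg _)] at hb
    rw [inv_pow, inv_pow]
    refine inv_anti₀ (by positivity) (hb.trans ?_)
    have h₂ : Real.exp (β / (2 * d)) / 2 ≤ Real.cosh (β / (2 * d)) := by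
      rw [Real.cosh_eq]
      linarith [Real.exp_pos (-(β / (2 * d)))]
    calc 1 / 4 * Real.exp ((d : ℝ)⁻¹ * β) = (Real.exp (β / (2 * d)) / 2) ^ 2 := by
          rw [div_pow, ← Real.exp_nat_mul]
          have : (d : ℝ)⁻¹ * β = ((2 : ℕ) : ℝ) * (β / (2 * d)) := by
            push_cast
            field_simp
          rw [this]
          ring
      _ ≤ _ := pow_le_pow_left₀ (by positivity) h₂ 2
  have hsmall : ∀ {f : ℝ → ℝ} (B : ℝ) {b : ℝ}, 0 < b → Tendsto f atTop (nhds 0) →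
      ∀ᶠ β in atTop, 2 * (f β * B) ≤ b := fun {f} B b hb hf => by
    have : Tendsto (fun β => 2 * (f β * B)) atTop (nhds 0) := by
      simpa using (hf.mul_const B).const_mul 2
    exact this.eventually_le_const hb
  obtain ⟨β₀, hβ₀⟩ := eventually_atTop.1 ((eventually_ge_atTop (1 : ℝ)).and
    ((hsmall 1 one_pos hpow).and ((hsmall M one_pos hpow).and (hexp.and
      ((hsmall 1 hlam hkap).and (hsmall A one_pos hkap))))))
  exact ⟨β₀, fun β hβ => by simpa only [mul_one] using hβ₀ β hβ⟩

end Parameters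

/-- Domination of the truncated two-point function by the killed Green function, for nonnegative
summable couplings. -/
theorem exists_forall_plusCov_le_gkrw {d : ℕ} (hd : 2 ≤ d) {J : Zd d → ℝ} (hJ : ∀ x, 0 ≤ J x)
    (hJe : ∀ x, J (-x) = J x) (hsum : Summable J)
    (hJ1 : ∀ k, J (unitVec k) = 1 ∧ J (-unitVec k) = 1) {lam : ℝ} (hlam : 0 < lam) :
    ∃ β₀ : ℝ, ∀ β : ℝ, β₀ ≤ β → ∀ N : ℕ, ∀ x : Zd d, x ≠ 0 →
      ∀ (h0 : (0 : Zd d) ∈ box d N) (hx : x ∈ box d N),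
        ENNReal.ofReal (plusCov d N β J 0 x h0 hx) ≤ ENNReal.ofReal 2 * Gkrw d lam J x := by
  obtain ⟨β₀, hβ₀⟩ := exists_threshold hd hlam (Fintype.card (EdgeMove d)) (∑' x, J x)
  refine ⟨β₀, fun β hβ N x hx0 h0 hx => ?_⟩
  obtain ⟨hβ1, hδ, hM, hcosh, hL, hA⟩ := hβ₀ β hβ
  have hβ0 : 0 < β := by linarith
  set L := β⁻¹ + 2 * β * β⁻¹ ^ d with hLdef
  have hL0 : 0 ≤ L := by positivity
  set μ := ENNReal.ofReal β⁻¹ with hμ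
  have hμpow : ∀ n, μ ^ n = ENNReal.ofReal (β⁻¹ ^ n) := fun n =>
    (ENNReal.ofReal_pow (by positivity) n).symm
  have htwo : (2 : ℝ≥0∞) = ENNReal.ofReal 2 := (ENNReal.ofReal_ofNat 2).symm
  have hμ1 : 2 * μ ^ d ≤ 1 := by
    rw [hμpow, htwo, ← ENNReal.ofReal_mul two_pos.le]
    exact ENNReal.ofReal_le_one.2 hδ
  have hμM : 2 * (μ ^ d * Fintype.card (EdgeMove d)) ≤ 1 := by
    rw [hμpow, htwo, ← ENNReal.ofReal_natCast, ← ENNReal.ofReal_mul (by positivity),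
      ← ENNReal.ofReal_mul two_pos.le]
    exact ENNReal.ofReal_le_one.2 hM
  have hker : μ + ENNReal.ofReal (2 * β) * μ ^ d = ENNReal.ofReal L := by
    rw [hμpow, ← ENNReal.ofReal_mul (by positivity), hμ,
      ← ENNReal.ofReal_add (by positivity) (by positivity)]
  set K : Zd d → Zd d → ℝ≥0∞ := fun a b => ENNReal.ofReal L * ENNReal.ofReal (J (b - a)) with hK
  have hKsum : ∀ a, 2 * ∑' b, K a b ≤ 1 := fun a => by
    have hshift : ∑' b, ENNReal.ofReal (J (b - a)) = ∑' y, ENNReal.ofReal (J y) :=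
      (Equiv.subRight a).tsum_eq fun y => ENNReal.ofReal (J y)
    rw [hK, ENNReal.tsum_mul_left, hshift, ← ENNReal.ofReal_tsum_of_nonneg hJ hsum, htwo,
      ← ENNReal.ofReal_mul hL0,
      ← ENNReal.ofReal_mul two_pos.le]
    exact ENNReal.ofReal_le_one.2 hA
  have hKle : ∀ a b, 2 * K a b ≤ ENNReal.ofReal (lam * J (b - a)) := fun a b => by
    simp only [hK]
    rw [htwo, ← ENNReal.ofReal_mul hL0, ← ENNReal.ofReal_mul two_pos.le, ← mul_assoc]
    exact ENNReal.ofReal_le_ofReal (mul_le_mul_of_nonneg_right hL (hJ _))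
  have hcontour : ∀ v u : Zd d,
      contourSum (ENNReal.ofReal ((Real.cosh (β / (2 * d)))⁻¹ ^ 2)) v u ≤
        μ ^ d * μ ^ l1Norm (u - v) := fun v u =>
    tsum_isContour_le (i₀ := ⟨0, by omega⟩) hμ1 hμM
      (by rw [hμpow]; exact ENNReal.ofReal_le_ofReal hcosh) v u
  have hsuper := tsum_contourSum_mul_le (κ := ENNReal.ofReal (2 * β))
    (j := fun y => ENNReal.ofReal (J y)) (fun k => by simp [hJ1]) hcontour x
  rw [hker] at hsuper
  have h01 : (⟨0, by omega⟩ : Fin d) ≠ ⟨1, by omega⟩ := by simp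
  calc ENNReal.ofReal (plusCov d N β J 0 x h0 hx) ≤ μ ^ d * greenSum K x 0 :=
        ofReal_plusCov_le h01 hβ0.le hJ hJe hsum hJ1 le_rfl
          (h := fun v => μ ^ d * greenSum K x v) hsuper h0 hx
    _ ≤ 1 * (2 * ∑' k, pathSum (fun a b => 2 * K a b) x k ∅ 0) :=
        mul_le_mul' (le_trans (by rw [two_mul]; exact le_self_add) hμ1)
          (greenSum_le_tsum_pathSum hKsum 0)
    _ ≤ ENNReal.ofReal 2 * Gkrw d lam J x := by
        rw [one_mul, ← htwo]
        exact mul_le_mul_right (tsum_pathSum_le_gkrw hJ hlam.le hKle hx0) _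

end PlusCov

/-- for `d ≥ 2`, a lattice-symmetric norm `ρ`, and couplings
`J(x) = ψ(x)e^{−ρ(x)}` with `ψ` subexponential, even, and `J = 1` on edges of length 1:
for every `λ > 0` there is `β_0` such that for every `β ≥ β_0` there is `C > 0` with
`Cov_{μ^+_{Λ_N;β}}(σ_0, σ_x) ≤ C·G^{KRW}_λ(0,x)` for every `N ≥ 1` and `0 ≠ x ∈ Λ_N`. -/
theorem statement14 {d : ℕ} (hd : 2 ≤ d)
    (ρ : (Fin d → ℝ) → ℝ)
    (hρ_tri : ∀ x y, ρ (x + y) ≤ ρ x + ρ y)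
    (hρ_hom : ∀ (c : ℝ) (x), ρ (c • x) = |c| * ρ x)
    (hρ_def : ∀ x, ρ x = 0 → x = 0)
    (hρ_perm : ∀ (π : Equiv.Perm (Fin d)) (x : Fin d → ℝ), ρ (x ∘ π) = ρ x)
    (hρ_sign : ∀ (ε : Fin d → ℝ), (∀ i, ε i = 1 ∨ ε i = -1) →
      ∀ x : Fin d → ℝ, ρ (fun i => ε i * x i) = ρ x)
    (ψ : Zd d → ℝ) (hψpos : ∀ x : Zd d, x ≠ 0 → 0 < ψ x)
    (hψsub : ∀ ε : ℝ, 0 < ε → ∃ R : ℝ, ∀ x : Zd d,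
      R ≤ eNorm x → |Real.log (ψ x)| ≤ ε * eNorm x)
    (J : Zd d → ℝ) (hJ0 : J 0 = 0)
    (hJdef : ∀ x : Zd d, x ≠ 0 → J x = ψ x * Real.exp (-ρ (toR x)))
    (hJe : ∀ x, J (-x) = J x)
    (hJ1 : ∀ x : Zd d, eNorm x = 1 → J x = 1) :
    ∀ lam : ℝ, 0 < lam → ∃ β₀ : ℝ, ∀ β : ℝ, β₀ ≤ β →
      ∃ C : ℝ, 0 < C ∧
        ∀ N : ℕ, 1 ≤ N → ∀ x : Zd d, x ≠ 0 →
          ∀ (h0 : (0 : Zd d) ∈ box d N) (hx : x ∈ box d N),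
            ENNReal.ofReal (plusCov d N β J 0 x h0 hx)
              ≤ ENNReal.ofReal C * Gkrw d lam J x := by
  have hJ : ∀ x, 0 ≤ J x := fun x => by
    by_cases hx : x = 0
    · rw [hx, hJ0]
    · rw [hJdef x hx]
      exact mul_nonneg (hψpos x hx).le (Real.exp_nonneg _)
  obtain ⟨c, hc, hρ⟩ := PlusCov.exists_mul_sum_abs_le hρ_tri hρ_hom hρ_def hρ_sign (by omega)
  have hsum : Summable J := PlusCov.summable_coupling hc hρ hψpos hψsub hJdef
  have hunit : ∀ k, J (PlusCov.unitVec k) = 1 ∧ J (-PlusCov.unitVec k) = 1 := fun k =>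
    ⟨hJ1 _ (PlusCov.eNorm_unitVec k), by rw [hJe, hJ1 _ (PlusCov.eNorm_unitVec k)]⟩
  intro lam hlam
  obtain ⟨β₀, hβ₀⟩ := PlusCov.exists_forall_plusCov_le_gkrw hd hJ hJe hsum hunit hlam
  exact ⟨β₀, fun β hβ => ⟨2, two_pos, fun N _ x hx h0 hxN => hβ₀ β hβ N x hx h0 hxN⟩⟩
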